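/- Let N ≥ 4 and 1 ≤ k < N − 2 be integers, let Γ ⊂ ℝ^N be a smooth compact embedded k-dimensional submanifold without boundary contained in a smooth domain Ω, and let q ∈ C²(Ω̄) with q ≥ 0 in Ω and max_{σ∈Γ} q(σ) = 1. Set δ(x) := dist(x, Γ), σ(x) the nearest-point projection onto Γ, ᾱ(x) := ((N−k−2)/2)²(1 − q(σ(x)) + δ(x)), α(x) := (N−k−2)/2 − √(ᾱ(x)), ω₀ := δ^{−α}, ω_a := ω₀|log δ|^a, and θ_a := ω₀ + ω_a for a < −1/2. Suppose p > 1 and u ∈ L^p_loc(Ω \ Γ) is nonnegative, not almost everywhere zero, has δ^{−2}q·u ∈ L¹_loc(Ω \ Γ), and satisfies ∫ u(−Δφ − ((N−k−2)²/4)δ^{−2}q φ) dx ≥ ∫ u^p φ dx for every nonnegative φ ∈ C_c^∞(Ω \ Γ). Then for every sufficiently small β > 0 there exists a constant C > 0 such that u ≥ C θ_a almost everywhere in Γ_β := {x ∈ Ω : δ(x) < β}. -/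

import Mathlib

open MeasureTheory Metric Filter
open scoped Topology ENNReal NNReal RealInnerProductSpace

noncomputable section

/-- `ℝ^N` as a Euclidean space. -/
abbrev Euc (N : ℕ) : Type := EuclideanSpace ℝ (Fin N)

/-- `φ ∈ C_c^∞(Ω)`: smooth functions with compact support contained in `Ω`. -/
def IsTestFun {N : ℕ} (Ω : Set (Euc N)) (φ : Euc N → ℝ) : Prop :=
  ContDiff ℝ (⊤ : ℕ∞) φ ∧ HasCompactSupport φ ∧ tsupport φ ⊆ Ω

/-- The classical Laplacian of `φ` at `x`: the sum of the pure second partial derivatives. -/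
def lap {N : ℕ} (φ : Euc N → ℝ) (x : Euc N) : ℝ :=
  ∑ i : Fin N, iteratedFDeriv ℝ 2 φ x ![EuclideanSpace.single i 1, EuclideanSpace.single i 1]

/-- A smooth domain of `ℝ^N`: a nonempty open connected set whose boundary is, near each of
its points, the zero set of a smooth function with non-vanishing differential, the domain
being the corresponding sublevel set. -/
def IsSmoothDomain {N : ℕ} (Ω : Set (Euc N)) : Prop :=
  IsOpen Ω ∧ Ω.Nonempty ∧ IsConnected Ω ∧
    ∀ x ∈ frontier Ω, ∃ (U : Set (Euc N)) (f : Euc N → ℝ),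
      IsOpen U ∧ x ∈ U ∧ ContDiff ℝ (⊤ : ℕ∞) f ∧ (∀ y ∈ U, fderiv ℝ f y ≠ 0) ∧
      Ω ∩ U = {y ∈ U | f y < 0} ∧ frontier Ω ∩ U = {y ∈ U | f y = 0}

/-- A smooth compact embedded `k`-dimensional submanifold of `ℝ^N` without boundary:
a nonempty compact set which is locally the zero set of a smooth submersion into `ℝ^{N-k}`. -/
def IsSmoothSubmanifold (N k : ℕ) (Γ : Set (Euc N)) : Prop :=
  IsCompact Γ ∧ Γ.Nonempty ∧
    ∀ x ∈ Γ, ∃ (U : Set (Euc N)) (f : Euc N → Euc (N - k)),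
      IsOpen U ∧ x ∈ U ∧ ContDiff ℝ (⊤ : ℕ∞) f ∧
      (∀ y ∈ U, Function.Surjective ⇑(fderiv ℝ f y)) ∧
      Γ ∩ U = {y ∈ U | f y = 0}

/-- `δ(x) = dist(x, Γ)`, the distance to `Γ`. -/
def distG {N : ℕ} (Γ : Set (Euc N)) (x : Euc N) : ℝ := Metric.infDist x Γ

/-- The tube `Γ_β = {x ∈ Ω : dist(x, Γ) < β}` around `Γ` inside `Ω`. -/
def tube {N : ℕ} (Ω Γ : Set (Euc N)) (β : ℝ) : Set (Euc N) :=
  {x ∈ Ω | distG Γ x < β}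

/-- The nearest-point projection onto `Γ`, `σ(x) = x - δ(x)∇δ(x)`. -/
def projG {N : ℕ} (Γ : Set (Euc N)) (x : Euc N) : Euc N :=
  x - distG Γ x • gradient (distG Γ) x

/-- `ᾱ(x) = ((N-k-2)/2)² (1 - q(σ(x)) + δ(x))`. -/
def abarF {N : ℕ} (k : ℕ) (Γ : Set (Euc N)) (q : Euc N → ℝ) (x : Euc N) : ℝ :=
  (((N : ℝ) - k - 2) / 2) ^ 2 * (1 - q (projG Γ x) + distG Γ x)

/-- `α(x) = (N-k-2)/2 - √(ᾱ(x))`. -/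
def alphaF {N : ℕ} (k : ℕ) (Γ : Set (Euc N)) (q : Euc N → ℝ) (x : Euc N) : ℝ :=
  ((N : ℝ) - k - 2) / 2 - Real.sqrt (abarF k Γ q x)

/-- `ω_a(x) = δ(x)^{-α(x)} |log δ(x)|^a`; in particular `ω_0 = δ^{-α}`. -/
def omegaA {N : ℕ} (k : ℕ) (Γ : Set (Euc N)) (q : Euc N → ℝ) (a : ℝ) (x : Euc N) : ℝ :=
  distG Γ x ^ (-(alphaF k Γ q x)) * |Real.log (distG Γ x)| ^ a

/-- `θ_a = ω_0 + ω_a`. -/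
def thetaA {N : ℕ} (k : ℕ) (Γ : Set (Euc N)) (q : Euc N → ℝ) (a : ℝ) (x : Euc N) : ℝ :=
  omegaA k Γ q 0 x + omegaA k Γ q a x



/-- coordinate vectors -/
abbrev ev {N : ℕ} (i : Fin N) : Euc N := EuclideanSpace.single i 1

/-- inner product of gradients -/
def gdot {N : ℕ} (φ ψ : Euc N → ℝ) (x : Euc N) : ℝ :=
  ∑ i : Fin N, fderiv ℝ φ x (ev i) * fderiv ℝ ψ x (ev i)

lemma lap_eq {N : ℕ} (φ : Euc N → ℝ) (x : Euc N) :
    lap φ x = ∑ i : Fin N, fderiv ℝ (fderiv ℝ φ) x (ev i) (ev i) := by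
  unfold lap
  refine Finset.sum_congr rfl fun i _ => ?_
  rw [iteratedFDeriv_two_apply]; rfl

lemma lap_congr {N : ℕ} {φ ψ : Euc N → ℝ} {x : Euc N} (h : φ =ᶠ[𝓝 x] ψ) : lap φ x = lap ψ x := by
  rw [lap_eq, lap_eq, (h.fderiv).fderiv_eq]

lemma gdot_congr {N : ℕ} {φ ψ φ' ψ' : Euc N → ℝ} {x : Euc N} (h : φ =ᶠ[𝓝 x] φ')
    (h' : ψ =ᶠ[𝓝 x] ψ') : gdot φ ψ x = gdot φ' ψ' x := by
  unfold gdot; rw [h.fderiv_eq, h'.fderiv_eq]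

lemma cd2_diff {N : ℕ} {φ : Euc N → ℝ} {x : Euc N} (h : ContDiffAt ℝ 2 φ x) :
    DifferentiableAt ℝ φ x := h.differentiableAt (by norm_num)

lemma cd2_ev {N : ℕ} {φ : Euc N → ℝ} {x : Euc N} (h : ContDiffAt ℝ 2 φ x) :
    ∀ᶠ y in 𝓝 x, DifferentiableAt ℝ φ y := by
  filter_upwards [h.eventually (by simp)] with y hy using cd2_diff hy

lemma cd2_fderiv {N : ℕ} {φ : Euc N → ℝ} {x : Euc N} (h : ContDiffAt ℝ 2 φ x) :
    DifferentiableAt ℝ (fderiv ℝ φ) x :=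
  (h.fderiv_right (m := 1) (by norm_num)).differentiableAt (by norm_num)

lemma lap_add {N : ℕ} {φ ψ : Euc N → ℝ} {x : Euc N} (h : ContDiffAt ℝ 2 φ x)
    (h' : ContDiffAt ℝ 2 ψ x) : lap (fun y => φ y + ψ y) x = lap φ x + lap ψ x := by
  have : fderiv ℝ (fun y => φ y + ψ y) =ᶠ[𝓝 x] fun y => fderiv ℝ φ y + fderiv ℝ ψ y := by
    filter_upwards [cd2_ev h, cd2_ev h'] with y hy hy'
    exact fderiv_fun_add hy hy'
  rw [lap_eq, lap_eq, lap_eq, this.fderiv_eq, fderiv_fun_add (cd2_fderiv h) (cd2_fderiv h'),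
    ← Finset.sum_add_distrib]
  rfl

lemma lap_mul {N : ℕ} {φ ψ : Euc N → ℝ} {x : Euc N} (h : ContDiffAt ℝ 2 φ x)
    (h' : ContDiffAt ℝ 2 ψ x) : lap (fun y => φ y * ψ y) x =
      φ x * lap ψ x + ψ x * lap φ x + 2 * gdot φ ψ x := by
  have : fderiv ℝ (fun y => φ y * ψ y) =ᶠ[𝓝 x]
      fun y => φ y • fderiv ℝ ψ y + ψ y • fderiv ℝ φ y := by
    filter_upwards [cd2_ev h, cd2_ev h'] with y hy hy'
    exact fderiv_fun_mul hy hy'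
  have e2 := ((cd2_diff h).hasFDerivAt.smul (cd2_fderiv h').hasFDerivAt).add
    ((cd2_diff h').hasFDerivAt.smul (cd2_fderiv h).hasFDerivAt)
  rw [lap_eq, lap_eq, lap_eq, this.fderiv_eq]
  have e3 := e2.fderiv
  simp only [Pi.add_def, Pi.smul_def'] at e3
  rw [e3, gdot, Finset.mul_sum, Finset.mul_sum, Finset.mul_sum, ← Finset.sum_add_distrib,
    ← Finset.sum_add_distrib]
  refine Finset.sum_congr rfl fun i _ => ?_
  simp
  ring

lemma lap_comp {N : ℕ} {φ : Euc N → ℝ} {x : Euc N} {g g' : ℝ → ℝ} {g'' : ℝ}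
    (h : ContDiffAt ℝ 2 φ x)
    (hg : ∀ᶠ t in 𝓝 (φ x), HasDerivAt g (g' t) t) (hg' : HasDerivAt g' g'' (φ x)) :
    lap (fun y => g (φ y)) x = g' (φ x) * lap φ x + g'' * gdot φ φ x := by
  have : fderiv ℝ (fun y => g (φ y)) =ᶠ[𝓝 x] fun y => g' (φ y) • fderiv ℝ φ y := by
    filter_upwards [cd2_ev h, h.continuousAt.eventually hg] with y hy hy'
    exact (hy'.comp_hasFDerivAt y hy.hasFDerivAt).fderiv
  have e1 : HasFDerivAt (fun y => g' (φ y)) (g'' • fderiv ℝ φ x) x :=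
    hg'.comp_hasFDerivAt x (cd2_diff h).hasFDerivAt
  have e2 := e1.smul (cd2_fderiv h).hasFDerivAt
  have e3 := e2.fderiv
  simp only [Pi.smul_def'] at e3
  rw [lap_eq, lap_eq, this.fderiv_eq, e3, gdot, Finset.mul_sum, Finset.mul_sum,
    ← Finset.sum_add_distrib]
  refine Finset.sum_congr rfl fun i _ => ?_
  simp
  ring

lemma fderiv_comp_ev {N : ℕ} {φ : Euc N → ℝ} {x : Euc N} {g : ℝ → ℝ} {g' : ℝ}
    (h : DifferentiableAt ℝ φ x) (hg : HasDerivAt g g' (φ x)) :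
    fderiv ℝ (fun y => g (φ y)) x = g' • fderiv ℝ φ x :=
  (hg.comp_hasFDerivAt x h.hasFDerivAt).fderiv

lemma lap_const_mul {N : ℕ} {φ : Euc N → ℝ} {x : Euc N} (c : ℝ) (h : ContDiffAt ℝ 2 φ x) :
    lap (fun y => c * φ y) x = c * lap φ x := by
  have := lap_comp (g := fun t => c * t) (g' := fun _ => c) (g'' := 0) h
    (Filter.Eventually.of_forall fun t => by simpa using (hasDerivAt_id t).const_mul c)
    (hasDerivAt_const _ _)
  simpa using this

lemma lap_sub {N : ℕ} {φ ψ : Euc N → ℝ} {x : Euc N} (h : ContDiffAt ℝ 2 φ x)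
    (h' : ContDiffAt ℝ 2 ψ x) : lap (fun y => φ y - ψ y) x = lap φ x - lap ψ x := by
  have h2 : ContDiffAt ℝ 2 (fun y => (-1 : ℝ) * ψ y) x := contDiffAt_const.mul h'
  have := lap_add h h2
  rw [lap_const_mul _ h'] at this
  rw [show (fun y => φ y - ψ y) = fun y => φ y + (-1) * ψ y by ext; ring, this]; ring

lemma gdot_sq_le {N : ℕ} (φ ψ : Euc N → ℝ) (x : Euc N) :
    gdot φ ψ x ^ 2 ≤ gdot φ φ x * gdot ψ ψ x := by
  unfold gdot
  have := Finset.sum_mul_sq_le_sq_mul_sq Finset.univ (fun i : Fin N => fderiv ℝ φ x (ev i))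
    (fun i => fderiv ℝ ψ x (ev i))
  simpa [sq] using this

lemma gdot_self_nonneg {N : ℕ} (φ : Euc N → ℝ) (x : Euc N) : 0 ≤ gdot φ φ x :=
  Finset.sum_nonneg fun _ _ => mul_self_nonneg _

lemma continuousAt_lap {N : ℕ} {φ : Euc N → ℝ} {x : Euc N} (h : ContDiffAt ℝ 2 φ x) :
    ContinuousAt (lap φ) x := by
  have h1 : ContDiffAt ℝ 0 (fderiv ℝ (fderiv ℝ φ)) x :=
    (h.fderiv_right (m := 1) (by norm_num)).fderiv_right (m := 0) (by norm_num)
  have h2 := h1.continuousAt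
  rw [show lap φ = fun x => ∑ i : Fin N, fderiv ℝ (fderiv ℝ φ) x (ev i) (ev i) from
    funext (lap_eq φ)]
  fun_prop

lemma continuousAt_gdot {N : ℕ} {φ : Euc N → ℝ} {x : Euc N} (h : ContDiffAt ℝ 2 φ x) :
    ContinuousAt (gdot φ φ) x := by
  have h2 := (h.fderiv_right (m := 1) (by norm_num)).continuousAt
  unfold gdot
  fun_prop

/-- second derivative test -/
lemma lap_nonneg_of_isLocalMin {N : ℕ} {φ : Euc N → ℝ} {x : Euc N} (h : ContDiffAt ℝ 2 φ x)
    (hm : IsLocalMin φ x) : 0 ≤ lap φ x := by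
  rw [lap_eq]
  refine Finset.sum_nonneg fun i _ => ?_
  by_contra! hneg
  set L : ℝ → Euc N := fun t => x + t • ev i with hL
  have hLc : Continuous L := by fun_prop
  have hL0 : L 0 = x := by simp [hL]
  have hLd : ∀ t, HasDerivAt L (ev i) t := fun t => by
    simpa [hL] using ((hasDerivAt_id t).smul_const (ev i)).const_add x
  have hd : ∀ᶠ t in 𝓝 (0:ℝ), HasDerivAt (fun t => φ (L t)) (fderiv ℝ φ (L t) (ev i)) t := by
    have : ∀ᶠ t in 𝓝 (0:ℝ), DifferentiableAt ℝ φ (L t) :=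
      hLc.continuousAt.eventually (by rw [hL0]; exact cd2_ev h)
    filter_upwards [this] with t ht
    exact ht.hasFDerivAt.comp_hasDerivAt t (hLd t)
  have hd2 : HasDerivAt (fun t => fderiv ℝ φ (L t) (ev i))
      (fderiv ℝ (fderiv ℝ φ) x (ev i) (ev i)) 0 := by
    have h1 : HasFDerivAt (fderiv ℝ φ) (fderiv ℝ (fderiv ℝ φ) x) (L 0) := by
      rw [hL0]; exact (cd2_fderiv h).hasFDerivAt
    have h2 := h1.comp_hasDerivAt (0:ℝ) (hLd 0)
    simpa using h2.clm_apply (hasDerivAt_const (0:ℝ) (ev i : Euc N))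
  have hm' : IsLocalMin (fun t => φ (L t)) 0 := by
    have : IsLocalMin φ (L 0) := by rw [hL0]; exact hm
    exact this.comp_continuous hLc.continuousAt
  have hd0 : fderiv ℝ φ (L 0) (ev i) = 0 := by
    have := hm'.hasDerivAt_eq_zero hd.self_of_nhds
    exact this
  have hder : deriv (fun t => φ (L t)) =ᶠ[𝓝 0] fun t => fderiv ℝ φ (L t) (ev i) := by
    filter_upwards [hd] with t ht using ht.deriv
  have hmax := isLocalMax_of_deriv_deriv_neg (f := fun t => φ (L t)) (x₀ := 0)
    (by rw [hder.deriv_eq, hd2.deriv]; exact hneg)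
    (by rw [hder.self_of_nhds]; exact hd0) hd.self_of_nhds.continuousAt
  have hconst : (fun t => φ (L t)) =ᶠ[𝓝 0] fun _ => φ (L 0) := by
    filter_upwards [hm', hmax] with t h1 h2
    exact le_antisymm h2 h1
  have e1 : deriv (fun t => φ (L t)) =ᶠ[𝓝 0] fun _ => 0 := by
    have := hconst.deriv
    simpa using this
  have e2 := (hder.symm.trans e1).deriv_eq
  rw [hd2.deriv] at e2
  simp at e2
  linarith



/-- a choice of nearest point -/
def nu {N : ℕ} (Γ : Set (Euc N)) (x : Euc N) : Euc N :=
  open Classical in if h : ∃ y ∈ Γ, Metric.infDist x Γ = dist x y then h.choose else x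

lemma nu_spec {N : ℕ} {Γ : Set (Euc N)} (hc : IsCompact Γ) (hne : Γ.Nonempty) (x : Euc N) :
    nu Γ x ∈ Γ ∧ Metric.infDist x Γ = dist x (nu Γ x) := by
  have h : ∃ y ∈ Γ, Metric.infDist x Γ = dist x y := hc.exists_infDist_eq_dist hne x
  unfold nu
  rw [dif_pos h]
  exact h.choose_spec

/-- transpose of a linear map as a smooth function of it -/
def tr {N m : ℕ} (A : Euc N →L[ℝ] Euc m) : Euc m →L[ℝ] Euc N :=
  ∑ i : Fin N, (innerSL ℝ (A (ev i))).smulRight (ev i)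

lemma inner_tr {N m : ℕ} (A : Euc N →L[ℝ] Euc m) (l : Euc m) (v : Euc N) :
    ⟪tr A l, v⟫ = ⟪l, A v⟫ := by
  have hv : v = ∑ i : Fin N, v i • ev i := by
    ext j; simp [Finset.sum_apply, Pi.single_apply]
  conv_rhs => rw [hv]
  simp only [tr, _root_.sum_apply, sum_inner, map_sum, inner_sum, map_smul,
    inner_smul_right, ContinuousLinearMap.smulRight_apply, inner_smul_left]
  refine Finset.sum_congr rfl fun i _ => ?_
  simp [EuclideanSpace.inner_single_left, real_inner_comm, mul_comm]

lemma tr_inj {N m : ℕ} (A : Euc N →L[ℝ] Euc m) (hA : Function.Surjective A) (l : Euc m)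
    (h : tr A l = 0) : l = 0 := by
  obtain ⟨v, hv⟩ := hA l
  have := inner_tr A l v
  rw [h, hv, inner_zero_left] at this
  exact inner_self_eq_zero.1 this.symm

lemma tr_eq_zero {N m : ℕ} (A : Euc N →L[ℝ] Euc m) (l : Euc m)
    (h : A (tr A l) = 0) : tr A l = 0 := by
  have := inner_tr A l (tr A l)
  rw [h, inner_zero_right] at this
  exact inner_self_eq_zero.1 this

lemma tr_contDiff {N m : ℕ} {n : WithTop ℕ∞} :
    ContDiff ℝ n (tr : (Euc N →L[ℝ] Euc m) → _) := by
  unfold tr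
  have h1 : ∀ i : Fin N, ContDiff ℝ n (fun A : Euc N →L[ℝ] Euc m => innerSL ℝ (A (ev i))) := by
    intro i
    exact (innerSL ℝ).contDiff.comp (ContinuousLinearMap.apply ℝ (Euc m) (ev i)).contDiff
  exact ContDiff.sum fun i _ => (h1 i).smulRight contDiff_const

/-- Lagrange multiplier for the nearest point -/
lemma lagrange {N m : ℕ} {Γ U : Set (Euc N)} {f : Euc N → Euc m} (hU : IsOpen U)
    (hf : ContDiff ℝ (⊤ : ℕ∞) f) {x y : Euc N} (hyU : y ∈ U) (hyΓ : y ∈ Γ)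
    (hsurj : Function.Surjective (fderiv ℝ f y))
    (hΓ : Γ ∩ U = {y ∈ U | f y = 0}) (hd : Metric.infDist x Γ = dist x y) :
    ∃ l : Euc m, x - y = tr (fderiv ℝ f y) l := by
  have hfy : f y = 0 := by
    have : y ∈ Γ ∩ U := ⟨hyΓ, hyU⟩
    rw [hΓ] at this; exact this.2
  have hmin : IsLocalMinOn (fun z => ‖z - x‖ ^ 2) {z | f z = f y} y := by
    have : ∀ᶠ z in 𝓝[{z | f z = f y}] y, z ∈ U := mem_nhdsWithin_of_mem_nhds (hU.mem_nhds hyU)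
    filter_upwards [this, self_mem_nhdsWithin] with z hz hz'
    have hzΓ : z ∈ Γ := by
      have : z ∈ {y ∈ U | f y = 0} := ⟨hz, by rw [← hfy]; exact hz'⟩
      rw [← hΓ] at this; exact this.1
    have := Metric.infDist_le_dist_of_mem (x := x) hzΓ
    rw [hd, dist_comm, dist_eq_norm, dist_comm, dist_eq_norm] at this
    gcongr
  have hs : HasStrictFDerivAt f (fderiv ℝ f y) y :=
    hf.contDiffAt.hasStrictFDerivAt (by simp)
  have hφ : HasStrictFDerivAt (fun z : Euc N => ‖z - x‖ ^ 2)
      ((2 : ℝ) • innerSL ℝ (y - x)) y := by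
    have h0 : HasStrictFDerivAt (fun z : Euc N => z - x) (ContinuousLinearMap.id ℝ _) y :=
      (hasStrictFDerivAt_id (𝕜 := ℝ) y).sub_const x
    have := HasStrictFDerivAt.comp y (hasStrictFDerivAt_norm_sq (y - x)) h0
    simpa [two_smul] using this
  obtain ⟨Λ, Λ₀, hne, h⟩ := IsLocalExtrOn.exists_linear_map_of_hasStrictFDerivAt
    (Or.inl hmin) hs hφ
  have hΛ₀ : Λ₀ ≠ 0 := by
    rintro rfl
    apply hne
    have : Λ = 0 := by
      ext w
      obtain ⟨v, hv⟩ := hsurj w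
      have := h v
      rw [hv] at this; simpa using this
    simp [this]
  let Λc : Euc m →L[ℝ] ℝ := LinearMap.toContinuousLinearMap Λ
  let w := (InnerProductSpace.toDual ℝ (Euc m)).symm Λc
  refine ⟨(1 / (2 * Λ₀)) • w, ?_⟩
  refine ext_inner_right ℝ fun v => ?_
  rw [inner_tr, inner_smul_left]
  have h1 : ⟪w, fderiv ℝ f y v⟫ = Λ (fderiv ℝ f y v) := by
    simp [w, Λc]
  have h2 := h v
  rw [h1]
  simp only [_root_.smul_apply, innerSL_apply_apply, smul_eq_mul] at h2
  have h3 : ⟪x - y, v⟫ = - ⟪y - x, v⟫ := by rw [← inner_neg_left, neg_sub]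
  rw [h3]
  simp
  field_simp
  linarith

/-- the normal-coordinates map -/
def Psi {N m : ℕ} (f : Euc N → Euc m) (z : Euc N × Euc m) : Euc N × Euc m :=
  (z.1 + tr (fderiv ℝ f z.1) z.2, f z.1)

lemma Psi_contDiff {N m : ℕ} {f : Euc N → Euc m} (hf : ContDiff ℝ (⊤ : ℕ∞) f) :
    ContDiff ℝ (⊤ : ℕ∞) (Psi f) := by
  have h1 : ContDiff ℝ (⊤ : ℕ∞) (fderiv ℝ f) := hf.fderiv_right (by simp)
  have h2 : ContDiff ℝ (⊤ : ℕ∞) (fun z : Euc N × Euc m => tr (fderiv ℝ f z.1)) :=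
    tr_contDiff.comp (h1.comp contDiff_fst)
  exact (contDiff_fst.add (h2.clm_apply contDiff_snd)).prodMk (hf.comp contDiff_fst)

def PsiLin {N m : ℕ} (A : Euc N →L[ℝ] Euc m) : Euc N × Euc m →L[ℝ] Euc N × Euc m :=
  (ContinuousLinearMap.fst ℝ _ _ + (tr A).comp (ContinuousLinearMap.snd ℝ _ _)).prod
    (A.comp (ContinuousLinearMap.fst ℝ _ _))

lemma Psi_hasFDerivAt {N m : ℕ} {f : Euc N → Euc m} (hf : ContDiff ℝ (⊤ : ℕ∞) f) (x₀ : Euc N) :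
    HasFDerivAt (Psi f) (PsiLin (fderiv ℝ f x₀)) (x₀, 0) := by
  have h1 : ContDiff ℝ (⊤ : ℕ∞) (fderiv ℝ f) := hf.fderiv_right (by simp)
  have h2 : ContDiff ℝ (⊤ : ℕ∞) (fun z : Euc N × Euc m => tr (fderiv ℝ f z.1)) :=
    tr_contDiff.comp (h1.comp contDiff_fst)
  have h3 := (h2.differentiable (by simp) (x₀, 0)).hasFDerivAt
  have h4 := h3.clm_apply (hasFDerivAt_snd (𝕜 := ℝ) (p := ((x₀, 0) : Euc N × Euc m)))
  have h5 := (hasFDerivAt_fst (𝕜 := ℝ) (p := ((x₀, 0) : Euc N × Euc m))).add h4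
  have h6 : HasFDerivAt (fun z : Euc N × Euc m => f z.1)
      ((fderiv ℝ f x₀).comp (ContinuousLinearMap.fst ℝ _ _)) (x₀, 0) :=
    HasFDerivAt.comp (x₀, 0) (hf.differentiable (by simp) x₀).hasFDerivAt hasFDerivAt_fst
  have h7 := h5.prodMk h6
  have h8 : PsiLin (fderiv ℝ f x₀) = (ContinuousLinearMap.fst ℝ (Euc N) (Euc m) +
          (tr (fderiv ℝ f (x₀, (0 : Euc m)).1) ∘SL ContinuousLinearMap.snd ℝ (Euc N) (Euc m) +
            (fderiv ℝ (fun z : Euc N × Euc m => tr (fderiv ℝ f z.1)) (x₀, 0)).flip (x₀, (0 : Euc m)).2)).prod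
      (fderiv ℝ f x₀ ∘SL ContinuousLinearMap.fst ℝ (Euc N) (Euc m)) := by
    apply ContinuousLinearMap.ext
    intro v
    simp [PsiLin]
  rw [h8]
  exact h7

lemma PsiLin_inj {N m : ℕ} (A : Euc N →L[ℝ] Euc m) (hA : Function.Surjective A) :
    Function.Injective (PsiLin A) := by
  rw [injective_iff_map_eq_zero]
  rintro ⟨h, μ⟩ hz
  simp only [PsiLin, ContinuousLinearMap.prod_apply, _root_.add_apply,
    ContinuousLinearMap.coe_fst', ContinuousLinearMap.comp_apply, ContinuousLinearMap.coe_snd',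
    Prod.mk_eq_zero] at hz
  obtain ⟨h1, h2⟩ := hz
  have h3 : A (tr A μ) = 0 := by
    have := congrArg A h1
    rw [map_add, h2, zero_add, map_zero] at this; exact this
  have h4 := tr_eq_zero A μ h3
  have h5 := tr_inj A hA μ h4
  rw [h4, add_zero] at h1
  simp [h1, h5]

def PsiEquiv {N m : ℕ} (A : Euc N →L[ℝ] Euc m) (hA : Function.Surjective A) :
    (Euc N × Euc m) ≃L[ℝ] (Euc N × Euc m) :=
  (LinearEquiv.ofInjectiveEndo (PsiLin A : Euc N × Euc m →ₗ[ℝ] Euc N × Euc m)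
    (PsiLin_inj A hA)).toContinuousLinearEquiv

lemma PsiEquiv_coe {N m : ℕ} (A : Euc N →L[ℝ] Euc m) (hA : Function.Surjective A) :
    (PsiEquiv A hA : Euc N × Euc m →L[ℝ] Euc N × Euc m) = PsiLin A := by
  apply ContinuousLinearMap.ext
  intro v
  simp [PsiEquiv]

/-- lower bound for transposes near a surjective map -/
lemma tr_lower {N m : ℕ} (A : Euc N →L[ℝ] Euc m) (hA : Function.Surjective A) :
    ∃ c > (0:ℝ), ∀ᶠ B in 𝓝 A, ∀ l, c * ‖l‖ ≤ ‖tr B l‖ := by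
  have hinj : Function.Injective (tr A) := by
    rw [injective_iff_map_eq_zero]; exact tr_inj A hA
  obtain ⟨K, hK, hK'⟩ := LinearMap.exists_antilipschitzWith
    (tr A : Euc m →ₗ[ℝ] Euc N) (LinearMap.ker_eq_bot.2 hinj)
  have hK0 : (0:ℝ) < K := by exact_mod_cast hK
  refine ⟨1 / (2 * K), by positivity, ?_⟩
  have hc : ContinuousAt (tr : (Euc N →L[ℝ] Euc m) → _) A :=
    (tr_contDiff (n := 0)).continuous.continuousAt
  have : ∀ᶠ B in 𝓝 A, dist (tr B) (tr A) < 1 / (2 * K) :=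
    Metric.tendsto_nhds.1 hc _ (by positivity)
  filter_upwards [this] with B hB l
  have h1 : ‖l‖ ≤ K * ‖tr A l‖ := by
    have := hK'.le_mul_dist l 0
    simpa using this
  have h2 : ‖tr B l - tr A l‖ ≤ 1 / (2 * K) * ‖l‖ := by
    rw [dist_eq_norm] at hB
    calc ‖tr B l - tr A l‖ = ‖(tr B - tr A) l‖ := by simp
      _ ≤ ‖tr B - tr A‖ * ‖l‖ := ContinuousLinearMap.le_opNorm _ _
      _ ≤ _ := by gcongr
  have h3 : ‖tr A l‖ ≤ ‖tr B l‖ + ‖tr B l - tr A l‖ := by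
    have := norm_sub_le (tr B l) (tr B l - tr A l)
    simpa using this
  have h4 : ‖l‖ / K ≤ ‖tr A l‖ := by rw [div_le_iff₀ hK0]; linarith
  have h5 : 1 / (2 * (K:ℝ)) * ‖l‖ = ‖l‖ / K / 2 := by field_simp
  rw [h5] at h2 ⊢
  linarith

/-- The nearest-point map near a point of the submanifold. -/
lemma nu_local {N k : ℕ} (hk : k ≤ N) {Γ : Set (Euc N)} (hΓ : IsSmoothSubmanifold N k Γ)
    {x₀ : Euc N} (hx₀ : x₀ ∈ Γ) :
    ContDiffAt ℝ (⊤ : ℕ∞) (nu Γ) x₀ ∧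
    ∃ p : Submodule ℝ (Euc N), Module.finrank ℝ p = k ∧
      LinearMap.IsProj p (fderiv ℝ (nu Γ) x₀ : Euc N →ₗ[ℝ] Euc N) := by
  obtain ⟨hcpt, hne, hloc⟩ := hΓ
  obtain ⟨U, f, hU, hxU, hf, hsurj, hΓU⟩ := hloc x₀ hx₀
  set A := fderiv ℝ f x₀ with hA
  have hAs : Function.Surjective A := hsurj x₀ hxU
  set e := PsiEquiv A hAs
  have hfx₀ : f x₀ = 0 := by
    have : x₀ ∈ Γ ∩ U := ⟨hx₀, hxU⟩
    rw [hΓU] at this; exact this.2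
  have hder : HasFDerivAt (Psi f) (e : Euc N × Euc (N-k) →L[ℝ] _) (x₀, 0) := by
    rw [PsiEquiv_coe]; exact Psi_hasFDerivAt hf x₀
  have hcd : ContDiffAt ℝ (⊤ : ℕ∞) (Psi f) (x₀, 0) := (Psi_contDiff hf).contDiffAt
  have hstr : HasStrictFDerivAt (Psi f) (e : Euc N × Euc (N-k) →L[ℝ] _) (x₀, 0) :=
    hcd.hasStrictFDerivAt' hder (by simp)
  have hPx : Psi f (x₀, 0) = (x₀, 0) := by simp [Psi, hfx₀]
  set g := hstr.localInverse (Psi f) e (x₀, 0) with hg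
  have hgcd : ContDiffAt ℝ (⊤ : ℕ∞) g (x₀, 0) := by
    have := hcd.to_localInverse hder (by simp)
    rw [hPx] at this; exact this
  have hgder : HasFDerivAt g (e.symm : Euc N × Euc (N-k) →L[ℝ] _) (x₀, 0) := by
    have := hstr.to_localInverse.hasFDerivAt
    rw [hPx] at this; exact this
  have hleft := hstr.eventually_left_inverse
  set s : Euc N → Euc N := fun x => (g (x, 0)).1 with hs
  -- eventually nu = s
  have hnu_tend : Tendsto (nu Γ) (𝓝 x₀) (𝓝 x₀) := by
    have hle : ∀ x, dist (nu Γ x) x₀ ≤ 2 * dist x x₀ := by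
      intro x
      have h1 := (nu_spec hcpt hne x).2
      have h2 := Metric.infDist_le_dist_of_mem (x := x) hx₀
      have h3 := dist_triangle (nu Γ x) x x₀
      rw [dist_comm (nu Γ x) x] at h3
      linarith
    rw [tendsto_iff_dist_tendsto_zero]
    refine squeeze_zero (fun _ => dist_nonneg) hle ?_
    have : Tendsto (fun x : Euc N => 2 * dist x x₀) (𝓝 x₀) (𝓝 (2 * dist x₀ x₀)) :=
      (Continuous.tendsto (by fun_prop) x₀)
    simpa using this
  obtain ⟨c, hc, hlow⟩ := tr_lower A hAs
  have hfd : ContinuousAt (fderiv ℝ f) x₀ :=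
    (hf.continuous_fderiv (by simp)).continuousAt
  have hlow' : ∀ᶠ x in 𝓝 x₀, ∀ l, c * ‖l‖ ≤ ‖tr (fderiv ℝ f (nu Γ x)) l‖ :=
    (hfd.tendsto.comp hnu_tend).eventually hlow
  have hUev : ∀ᶠ x in 𝓝 x₀, nu Γ x ∈ U := hnu_tend.eventually (hU.mem_nhds hxU)
  have hlag : ∀ᶠ x in 𝓝 x₀, ∃ l : Euc (N - k), x - nu Γ x = tr (fderiv ℝ f (nu Γ x)) l ∧
      ‖l‖ ≤ c⁻¹ * dist x x₀ := by
    filter_upwards [hlow', hUev] with x h1 h2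
    obtain ⟨l, hl⟩ := lagrange hU hf h2 (nu_spec hcpt hne x).1 (hsurj _ h2) hΓU
      (nu_spec hcpt hne x).2
    refine ⟨l, hl, ?_⟩
    have h3 := h1 l
    rw [← hl, ← dist_eq_norm, ← (nu_spec hcpt hne x).2] at h3
    have h4 := Metric.infDist_le_dist_of_mem (x := x) hx₀
    rw [le_inv_mul_iff₀ hc]
    linarith
  have hev : nu Γ =ᶠ[𝓝 x₀] s := by
    rw [nhds_prod_eq] at hleft
    obtain ⟨pa, ha, pb, hb, hab⟩ := Filter.eventually_prod_iff.1 hleft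
    have hb' : ∀ᶠ t in 𝓝 (0:ℝ), ∀ l : Euc (N-k), ‖l‖ ≤ t → pb l := by
      obtain ⟨ε, hε, hε'⟩ := Metric.eventually_nhds_iff.1 hb
      filter_upwards [gt_mem_nhds hε] with t ht l hl
      exact hε' (by simpa using lt_of_le_of_lt hl ht)
    have ht : Tendsto (fun x : Euc N => c⁻¹ * dist x x₀) (𝓝 x₀) (𝓝 0) := by
      have : Tendsto (fun x : Euc N => c⁻¹ * dist x x₀) (𝓝 x₀) (𝓝 (c⁻¹ * dist x₀ x₀)) :=
        (Continuous.tendsto (by fun_prop) x₀)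
      simpa using this
    filter_upwards [hlag, hnu_tend.eventually ha, ht.eventually hb', hUev] with x ⟨l, hl, hl'⟩ h1 h2 h3
    have h4 := hab h1 (h2 l hl')
    have h5 : Psi f (nu Γ x, l) = (x, 0) := by
      have : f (nu Γ x) = 0 := by
        have : nu Γ x ∈ Γ ∩ U := ⟨(nu_spec hcpt hne x).1, h3⟩
        rw [hΓU] at this; exact this.2
      simp [Psi, this, ← hl]
    rw [h5] at h4
    simp [hs, hg, h4]
  have hpair : HasFDerivAt (fun x : Euc N => ((x, 0) : Euc N × Euc (N-k)))
      (ContinuousLinearMap.inl ℝ _ _) x₀ := hasFDerivAt_prodMk_left x₀ 0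
  have hscd : ContDiffAt ℝ (⊤ : ℕ∞) s x₀ := by
    have h1 : ContDiffAt ℝ (⊤ : ℕ∞) (fun x : Euc N => ((x, 0) : Euc N × Euc (N-k))) x₀ :=
      contDiffAt_id.prodMk contDiffAt_const
    exact contDiffAt_fst.comp x₀ (ContDiffAt.comp x₀ hgcd h1)
  have hsd : HasFDerivAt s ((ContinuousLinearMap.fst ℝ _ _).comp
      ((e.symm : Euc N × Euc (N-k) →L[ℝ] _).comp (ContinuousLinearMap.inl ℝ _ _))) x₀ :=
    hasFDerivAt_fst.comp x₀ (HasFDerivAt.comp (g := g) x₀ hgder hpair)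
  refine ⟨hscd.congr_of_eventuallyEq hev, LinearMap.ker (A : Euc N →ₗ[ℝ] Euc (N-k)), ?_, ?_⟩
  · have := LinearMap.finrank_range_add_finrank_ker (A : Euc N →ₗ[ℝ] Euc (N-k))
    rw [LinearMap.range_eq_top.2 hAs, finrank_top] at this
    simp at this
    omega
  · rw [hev.fderiv_eq, hsd.fderiv]
    have key : ∀ v : Euc N, PsiLin A (e.symm (v, 0)) = (v, 0) := by
      intro v
      rw [← PsiEquiv_coe A hAs]
      exact e.apply_symm_apply (v, 0)
    constructor
    · intro v
      have := congrArg Prod.snd (key v)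
      simpa [PsiLin] using this
    · intro v hv
      have hv' : A v = 0 := hv
      have : e.symm (v, 0) = (v, 0) := by
        rw [ContinuousLinearEquiv.symm_apply_eq]
        have : e (v, 0) = PsiLin A (v, 0) := by rw [← PsiEquiv_coe A hAs]; rfl
        rw [this]
        simp [PsiLin, hv']
      simp [this]



lemma vol_zero {N k : ℕ} (hk : k < N) {Γ : Set (Euc N)} (hΓ : IsSmoothSubmanifold N k Γ) :
    volume Γ = 0 := by
  have himg : nu Γ '' Γ = Γ := by
    have : ∀ x ∈ Γ, nu Γ x = x := by
      intro x hx
      have h := (nu_spec hΓ.1 hΓ.2.1 x).2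
      rw [Metric.infDist_zero_of_mem hx] at h
      exact (dist_eq_zero.1 h.symm).symm
    rw [Set.image_congr this, Set.image_id']
  rw [← himg]
  refine addHaar_image_eq_zero_of_det_fderivWithin_eq_zero volume
    (f' := fun x => fderiv ℝ (nu Γ) x) ?_ ?_
  · intro x hx
    exact (((nu_local hk.le hΓ hx).1.differentiableAt (by simp)).hasFDerivAt).hasFDerivWithinAt
  · intro x hx
    obtain ⟨p, hp, hproj⟩ := (nu_local hk.le hΓ hx).2
    rw [ContinuousLinearMap.det, LinearMap.det_eq_zero_iff_ker_ne_bot]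
    intro hker
    have hr := (LinearMap.ker_eq_bot_iff_range_eq_top
      (f := (fderiv ℝ (nu Γ) x : Euc N →ₗ[ℝ] Euc N))).1 hker
    rw [hproj.range] at hr
    subst hr
    rw [finrank_top] at hp
    simp at hp
    omega

lemma rho_eq {N : ℕ} {Γ : Set (Euc N)} (hc : IsCompact Γ) (hne : Γ.Nonempty) :
    (fun x => distG Γ x ^ 2) = fun x => ‖x - nu Γ x‖ ^ 2 := by
  ext x
  rw [distG, (nu_spec hc hne x).2, dist_eq_norm]

lemma rho_fderiv {N : ℕ} {Γ : Set (Euc N)} (hc : IsCompact Γ) (hne : Γ.Nonempty) {x : Euc N}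
    (hx : DifferentiableAt ℝ (nu Γ) x) :
    HasFDerivAt (fun x => distG Γ x ^ 2) ((2:ℝ) • innerSL ℝ (x - nu Γ x)) x := by
  have hd : DifferentiableAt ℝ (fun x => distG Γ x ^ 2) x := by
    rw [rho_eq hc hne]
    exact (differentiableAt_id.sub hx).norm_sq ℝ
  have hq : HasFDerivAt (fun z : Euc N => ‖z - nu Γ x‖ ^ 2) ((2:ℝ) • innerSL ℝ (x - nu Γ x)) x := by
    have h0 : HasStrictFDerivAt (fun z : Euc N => z - nu Γ x) (ContinuousLinearMap.id ℝ _) x :=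
      (hasStrictFDerivAt_id (𝕜 := ℝ) x).sub_const _
    have := (HasStrictFDerivAt.comp x (hasStrictFDerivAt_norm_sq (x - nu Γ x)) h0).hasFDerivAt
    simpa [two_smul] using this
  have hmin : IsLocalMin (fun z => ‖z - nu Γ x‖ ^ 2 - distG Γ z ^ 2) x := by
    refine Filter.Eventually.of_forall fun z => ?_
    have h1 : distG Γ x = ‖x - nu Γ x‖ := by
      rw [distG, (nu_spec hc hne x).2, dist_eq_norm]
    have h2 : distG Γ z ≤ ‖z - nu Γ x‖ := by
      rw [← dist_eq_norm]; exact Metric.infDist_le_dist_of_mem (nu_spec hc hne x).1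
    have h3 : 0 ≤ distG Γ z := Metric.infDist_nonneg
    simp only [h1, sub_self]
    have := pow_le_pow_left₀ h3 h2 2
    linarith
  have h0 := hmin.hasFDerivAt_eq_zero (hq.sub hd.hasFDerivAt)
  rw [sub_eq_zero] at h0
  rw [h0]; exact hd.hasFDerivAt

lemma rho_gdot {N : ℕ} {Γ : Set (Euc N)} (hc : IsCompact Γ) (hne : Γ.Nonempty) {x : Euc N}
    (hx : DifferentiableAt ℝ (nu Γ) x) :
    gdot (fun x => distG Γ x ^ 2) (fun x => distG Γ x ^ 2) x = 4 * distG Γ x ^ 2 := by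
  unfold gdot
  rw [(rho_fderiv hc hne hx).fderiv, congrFun (rho_eq hc hne) x, EuclideanSpace.norm_sq_eq,
    Finset.mul_sum]
  refine Finset.sum_congr rfl fun i _ => ?_
  rw [Real.norm_eq_abs, sq_abs]
  simp [EuclideanSpace.inner_single_right]
  ring

lemma rho_cd {N : ℕ} {Γ : Set (Euc N)} (hc : IsCompact Γ) (hne : Γ.Nonempty) {x : Euc N}
    (hx : ContDiffAt ℝ 2 (nu Γ) x) : ContDiffAt ℝ 2 (fun x => distG Γ x ^ 2) x := by
  rw [rho_eq hc hne]
  exact (contDiffAt_id.sub hx).norm_sq ℝ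

lemma rho_lap {N : ℕ} {Γ : Set (Euc N)} (hc : IsCompact Γ) (hne : Γ.Nonempty) {x : Euc N}
    (hx : ContDiffAt ℝ 2 (nu Γ) x) :
    lap (fun x => distG Γ x ^ 2) x =
      2 * N - 2 * ∑ i, ⟪(ev i : Euc N), fderiv ℝ (nu Γ) x (ev i)⟫ := by
  have hev : fderiv ℝ (fun x => distG Γ x ^ 2) =ᶠ[𝓝 x]
      fun y => (2:ℝ) • innerSL ℝ (y - nu Γ y) := by
    filter_upwards [hx.eventually (by simp)] with y hy
    exact (rho_fderiv hc hne (hy.differentiableAt (by norm_num))).fderiv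
  have hd : HasFDerivAt (fun y => (2:ℝ) • innerSL ℝ (y - nu Γ y))
      ((2:ℝ) • (innerSL ℝ).comp (ContinuousLinearMap.id ℝ (Euc N) - fderiv ℝ (nu Γ) x)) x := by
    have h1 : HasFDerivAt (fun y => y - nu Γ y)
        (ContinuousLinearMap.id ℝ (Euc N) - fderiv ℝ (nu Γ) x) x :=
      (hasFDerivAt_id x).sub (hx.differentiableAt (by norm_num)).hasFDerivAt
    exact ((innerSL ℝ).hasFDerivAt.comp x h1).const_smul (2:ℝ)
  rw [lap_eq, hev.fderiv_eq, hd.fderiv]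
  have hN : (2:ℝ) * N = ∑ i : Fin N, 2 := by simp [mul_comm]
  rw [hN, Finset.mul_sum, ← Finset.sum_sub_distrib]
  refine Finset.sum_congr rfl fun i _ => ?_
  have hone : ((innerSL ℝ) (ev i : Euc N)) (ev i) = 1 := by
    rw [innerSL_apply_apply]; simp [ev]
  simp [real_inner_comm, mul_sub, hone]

lemma projG_eq {N : ℕ} {Γ : Set (Euc N)} (hc : IsCompact Γ) (hne : Γ.Nonempty) {x : Euc N}
    (hx : DifferentiableAt ℝ (nu Γ) x) (hpos : 0 < distG Γ x) : projG Γ x = nu Γ x := by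
  have h1 := rho_fderiv hc hne hx
  have h2 : HasFDerivAt (distG Γ) ((1 / (2 * distG Γ x)) • ((2:ℝ) • innerSL ℝ (x - nu Γ x))) x := by
    have h3 : HasDerivAt Real.sqrt (1 / (2 * √(distG Γ x ^ 2))) (distG Γ x ^ 2) :=
      Real.hasDerivAt_sqrt (by positivity)
    have h4 := h3.comp_hasFDerivAt x h1
    rw [Real.sqrt_sq hpos.le] at h4
    have : (Real.sqrt ∘ fun x => distG Γ x ^ 2) = distG Γ := by
      ext y; simp [Real.sqrt_sq (show 0 ≤ distG Γ y from Metric.infDist_nonneg)]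
    rwa [this] at h4
  have h5 : gradient (distG Γ) x = (distG Γ x)⁻¹ • (x - nu Γ x) := by
    unfold gradient
    rw [h2.fderiv]
    apply (InnerProductSpace.toDual ℝ (Euc N)).injective
    rw [LinearIsometryEquiv.apply_symm_apply]
    ext v
    simp only [_root_.smul_apply, innerSL_apply_apply, InnerProductSpace.toDual_apply_apply,
      inner_smul_left, smul_eq_mul]
    simp
    field_simp
  rw [projG, h5, smul_smul, mul_inv_cancel₀ hpos.ne', one_smul]
  abel

lemma lip_nu {N : ℕ} {Γ W : Set (Euc N)} (hc : IsCompact Γ) (hne : Γ.Nonempty) (hW : IsOpen W)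
    (hΓW : Γ ⊆ W) {g : Euc N → ℝ} (hg : ∀ x ∈ W, ContDiffAt ℝ 1 g x) :
    ∃ R > (0:ℝ), ∃ C > (0:ℝ), ∀ x, distG Γ x ≤ R → |g x - g (nu Γ x)| ≤ C * distG Γ x := by
  obtain ⟨R, hR, hRW⟩ := hc.exists_cthickening_subset_open hW hΓW
  have hcc : IsCompact (Metric.cthickening R Γ) := hc.cthickening
  have hcont : ContinuousOn (fderiv ℝ g) (Metric.cthickening R Γ) := fun x hx =>
    ((hg x (hRW hx)).fderiv_right (m := 0) (by norm_num)).continuousAt.continuousWithinAt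
  obtain ⟨C, hC⟩ := hcc.exists_bound_of_continuousOn hcont
  refine ⟨R, hR, max C 1, by positivity, fun x hx => ?_⟩
  have hs := nu_spec hc hne x
  have hseg : segment ℝ (nu Γ x) x ⊆ Metric.cthickening R Γ := by
    intro z hz
    refine Metric.mem_cthickening_of_dist_le z (nu Γ x) R Γ hs.1 ?_
    have h1 : dist z (nu Γ x) ≤ dist x (nu Γ x) := by
      obtain ⟨t, ht, rfl⟩ := (segment_eq_image' ℝ (nu Γ x) x ▸ hz :
        z ∈ (fun θ : ℝ => nu Γ x + θ • (x - nu Γ x)) '' Set.Icc 0 1)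
      rw [dist_eq_norm, dist_eq_norm, add_sub_cancel_left, norm_smul, Real.norm_eq_abs,
        abs_of_nonneg ht.1]
      exact mul_le_of_le_one_left (norm_nonneg _) ht.2
    rw [distG, hs.2] at hx
    linarith
  have := (convex_segment (nu Γ x) x).norm_image_sub_le_of_norm_fderiv_le (𝕜 := ℝ) (f := g)
    (C := max C 1)
    (fun z hz => (hg z (hRW (hseg hz))).differentiableAt (by norm_num))
    (fun z hz => (hC z (hseg hz)).trans (le_max_left _ _))
    (left_mem_segment ℝ _ _) (right_mem_segment ℝ _ _)
  rw [distG, hs.2, dist_eq_norm]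
  exact this

/-- All the geometric facts on a small tube. -/
lemma tube_geometry {N k : ℕ} (hk : k < N) {Γ : Set (Euc N)} (hΓ : IsSmoothSubmanifold N k Γ) :
    ∃ W : Set (Euc N), IsOpen W ∧ Γ ⊆ W ∧ (∀ x ∈ W, ContDiffAt ℝ 2 (nu Γ) x) ∧
      ∃ R > (0:ℝ), ∃ C > (0:ℝ), ∀ x, distG Γ x ≤ R → x ∈ W ∧
        |lap (fun x => distG Γ x ^ 2) x - 2 * ((N:ℝ) - k)| ≤ C * distG Γ x := by
  obtain ⟨hc, hne, -⟩ := id hΓ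
  set W := {x | ContDiffAt ℝ 3 (nu Γ) x} with hW
  have hWo : IsOpen W := by
    rw [isOpen_iff_mem_nhds]
    intro x hx
    exact ContDiffAt.eventually hx (by simp)
  have hΓW : Γ ⊆ W := fun x hx => by
    have h := (nu_local hk.le hΓ hx).1
    have h' : ContDiffAt ℝ 3 (nu Γ) x := h.of_le (WithTop.coe_le_coe.2 (le_top : (3:ℕ∞) ≤ ⊤))
    exact h'
  have h2 : ∀ x ∈ W, ContDiffAt ℝ 2 (nu Γ) x := fun x hx => by
    have h' : ContDiffAt ℝ 3 (nu Γ) x := hx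
    exact h'.of_le (by norm_num)
  refine ⟨W, hWo, hΓW, h2, ?_⟩
  set t : Euc N → ℝ := fun x => ∑ i, ⟪(ev i : Euc N), fderiv ℝ (nu Γ) x (ev i)⟫ with ht
  have htc : ∀ x ∈ W, ContDiffAt ℝ 1 t x := by
    intro x hx
    have h' : ContDiffAt ℝ 3 (nu Γ) x := hx
    have h3 : ContDiffAt ℝ 1 (fderiv ℝ (nu Γ)) x := h'.fderiv_right (by norm_num)
    refine ContDiffAt.sum fun i _ => ?_
    exact contDiffAt_const.inner ℝ (h3.clm_apply contDiffAt_const)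
  obtain ⟨R, hR, C, hC, hlip⟩ := lip_nu hc hne hWo hΓW htc
  obtain ⟨R', hR', hRW⟩ := hc.exists_cthickening_subset_open hWo hΓW
  refine ⟨min R R', by positivity, 2 * C, by positivity, fun x hx => ?_⟩
  have hxW : x ∈ W := by
    apply hRW
    refine Metric.mem_cthickening_of_dist_le x (nu Γ x) R' Γ (nu_spec hc hne x).1 ?_
    rw [← (nu_spec hc hne x).2]; exact hx.trans (min_le_right _ _)
  refine ⟨hxW, ?_⟩
  have htr : t (nu Γ x) = k := by
    obtain ⟨p, hp, hproj⟩ := (nu_local hk.le hΓ (nu_spec hc hne x).1).2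
    have h3 := hproj.trace
    rw [hp, LinearMap.trace_eq_sum_inner _ (EuclideanSpace.basisFun (Fin N) ℝ)] at h3
    rw [← h3]
    simp [ht]
  have h4 := hlip x (hx.trans (min_le_left _ _))
  rw [htr] at h4
  rw [rho_lap hc hne (h2 x hxW)]
  change |2 * (N:ℝ) - 2 * t x - 2 * (N - k)| ≤ _
  rw [show 2 * (N:ℝ) - 2 * t x - 2 * (N - k) = (-2) * (t x - k) by ring, abs_mul]
  norm_num
  linarith

lemma ball_diff_conn {m : ℕ} (hm : 1 < m) (r : ℝ) (hr : 0 < r) :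
    IsPreconnected (ball (0 : Euc m) r \ {0}) := by
  have h1 : IsConnected ({(0 : Euc m)}ᶜ) := by
    apply isConnected_compl_singleton_of_one_lt_rank
    apply Module.one_lt_rank_of_one_lt_finrank
    simpa using hm
  have hcont : Continuous (fun x : Euc m => (r / (1 + ‖x‖)) • x) := by
    have h0 : ∀ x : Euc m, 1 + ‖x‖ ≠ 0 := fun x => by positivity
    have h2 : Continuous (fun x : Euc m => r / (1 + ‖x‖)) :=
      Continuous.div continuous_const (continuous_const.add continuous_norm) h0
    exact h2.smul continuous_id
  have : ball (0 : Euc m) r \ {0} = (fun x : Euc m => (r / (1 + ‖x‖)) • x) '' {0}ᶜ := by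
    ext y
    constructor
    · rintro ⟨hy, hy0⟩
      have hy' : ‖y‖ < r := by simpa using hy
      have hy0' : y ≠ 0 := hy0
      refine ⟨(1 / (r - ‖y‖)) • y, ?_, ?_⟩
      · simp [hy0', sub_ne_zero, hy'.ne']
      · have h3 : 0 < r - ‖y‖ := by linarith
        have h2 : ‖(1 / (r - ‖y‖)) • y‖ = ‖y‖ / (r - ‖y‖) := by
          rw [norm_smul, Real.norm_eq_abs, abs_of_pos (by positivity)]; ring
        simp only [h2, smul_smul]
        have : r / (1 + ‖y‖ / (r - ‖y‖)) * (1 / (r - ‖y‖)) = 1 := by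
          field_simp; ring
        rw [this, one_smul]
    · rintro ⟨x, hx, rfl⟩
      have hx' : x ≠ 0 := hx
      refine ⟨?_, ?_⟩
      · simp only [mem_ball, dist_zero_right, norm_smul, Real.norm_eq_abs]
        rw [abs_of_pos (by positivity), div_mul_eq_mul_div, div_lt_iff₀ (by positivity)]
        nlinarith
      · simp only [Set.mem_singleton_iff, smul_eq_zero, not_or]
        exact ⟨by positivity, hx'⟩
  rw [this]
  exact h1.isPreconnected.image _ hcont.continuousOn

lemma local_conn {N k : ℕ} (hk : k + 2 < N) {Γ : Set (Euc N)} (hΓ : IsSmoothSubmanifold N k Γ)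
    {x₀ : Euc N} (hx₀ : x₀ ∈ Γ) {O : Set (Euc N)} (hO : IsOpen O) (hxO : x₀ ∈ O) :
    ∃ V : Set (Euc N), IsOpen V ∧ x₀ ∈ V ∧ V ⊆ O ∧ IsPreconnected (V \ Γ) := by
  obtain ⟨hcpt, hne, hloc⟩ := hΓ
  obtain ⟨U, f, hU, hxU, hf, hsurj, hΓU⟩ := hloc x₀ hx₀
  have hs : HasStrictFDerivAt f (fderiv ℝ f x₀) x₀ :=
    hf.contDiffAt.hasStrictFDerivAt (by simp)
  have hfx₀ : f x₀ = 0 := by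
    have : x₀ ∈ Γ ∩ U := ⟨hx₀, hxU⟩
    rw [hΓU] at this; exact this.2
  have hrange : (fderiv ℝ f x₀ : Euc N →ₗ[ℝ] Euc (N-k)).range = ⊤ :=
    LinearMap.range_eq_top.2 (hsurj x₀ hxU)
  set e := hs.implicitToOpenPartialHomeomorph f (fderiv ℝ f x₀) hrange with he
  have hsrc : x₀ ∈ e.source := hs.mem_implicitToOpenPartialHomeomorph_source hrange
  have hfst : ∀ x, (e x).1 = f x := fun x => hs.implicitToOpenPartialHomeomorph_fst hrange x
  have hx0' : e x₀ = (f x₀, 0) := hs.implicitToOpenPartialHomeomorph_self hrange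
  have hopen : IsOpen (e.target ∩ e.symm ⁻¹' (U ∩ O)) :=
    e.symm.isOpen_inter_preimage (hU.inter hO)
  have hmem : e x₀ ∈ e.target ∩ e.symm ⁻¹' (U ∩ O) :=
    ⟨e.map_source hsrc, by simpa [e.left_inv hsrc] using ⟨hxU, hxO⟩⟩
  obtain ⟨r, hr, hball⟩ := Metric.isOpen_iff.1 hopen _ hmem
  rw [hx0', hfx₀] at hball
  refine ⟨e.source ∩ e ⁻¹' (ball (0, 0) r), e.isOpen_inter_preimage isOpen_ball, ⟨hsrc, ?_⟩, ?_, ?_⟩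
  · simp [hx0', hfx₀, hr]
  · rintro x ⟨h1, h2⟩
    have := (hball h2).2.2
    simpa [e.left_inv h1] using this
  · have heq : (e.source ∩ e ⁻¹' (ball (0, 0) r)) \ Γ =
        e.symm '' ((ball (0 : Euc (N-k)) r \ {0}) ×ˢ
          ball (0 : (fderiv ℝ f x₀ : Euc N →ₗ[ℝ] Euc (N-k)).ker) r) := by
      ext x
      constructor
      · rintro ⟨⟨h1, h2⟩, h3⟩
        refine ⟨e x, ?_, e.left_inv h1⟩
        have h2' : e x ∈ ball ((0, 0) : Euc (N-k) × (fderiv ℝ f x₀ : Euc N →ₗ[ℝ] Euc (N-k)).ker) r := h2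
        have h4 : x ∈ U := by
          have := (hball h2').2.1
          simpa [e.left_inv h1] using this
        rw [← ball_prod_same] at h2'
        refine ⟨⟨h2'.1, ?_⟩, h2'.2⟩
        intro h5
        apply h3
        have : x ∈ {y ∈ U | f y = 0} := ⟨h4, by rw [← hfst]; exact h5⟩
        rw [← hΓU] at this; exact this.1
      · rintro ⟨y, ⟨⟨h1, h2⟩, h3⟩, rfl⟩
        have hy : y ∈ ball ((0, 0) : Euc (N-k) × (fderiv ℝ f x₀ : Euc N →ₗ[ℝ] Euc (N-k)).ker) r := by
          rw [← ball_prod_same]; exact ⟨h1, h3⟩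
        have hyt := (hball hy).1
        refine ⟨⟨e.map_target hyt, ?_⟩, ?_⟩
        · simpa only [Set.mem_preimage, e.right_inv hyt] using hy
        · intro h4
          apply h2
          have h5 : e.symm y ∈ Γ ∩ U := ⟨h4, (hball hy).2.1⟩
          rw [hΓU] at h5
          have h6 := h5.2
          rw [← hfst, e.right_inv hyt] at h6
          exact h6
    rw [heq]
    have hpre : IsPreconnected ((ball (0 : Euc (N-k)) r \ {0}) ×ˢ
          ball (0 : (fderiv ℝ f x₀ : Euc N →ₗ[ℝ] Euc (N-k)).ker) r) :=
      (ball_diff_conn (by omega) r hr).prod (convex_ball _ _).isPreconnected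
    refine hpre.image _ (e.continuousOn_symm.mono ?_)
    rintro y ⟨⟨h1, h2⟩, h3⟩
    have hy : y ∈ ball ((0, 0) : Euc (N-k) × (fderiv ℝ f x₀ : Euc N →ₗ[ℝ] Euc (N-k)).ker) r := by
      rw [← ball_prod_same]; exact ⟨h1, h3⟩
    exact (hball hy).1

lemma diff_preconnected {N k : ℕ} (hk : k + 2 < N) {Γ Ω : Set (Euc N)}
    (hΓ : IsSmoothSubmanifold N k Γ) (hΩo : IsOpen Ω) (hΩ : IsPreconnected Ω) :
    IsPreconnected (Ω \ Γ) := by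
  have hvol := vol_zero (by omega) hΓ
  have hcl : IsClosed Γ := hΓ.1.isClosed
  have hIntg : ∀ x : Euc N, ∀ V ∈ 𝓝 x, (V \ Γ).Nonempty := by
    intro x V hV
    by_contra h
    rw [Set.not_nonempty_iff_eq_empty, Set.sdiff_eq_empty] at h
    have h1 : volume V = 0 := measure_mono_null h hvol
    exact (MeasureTheory.Measure.measure_pos_of_mem_nhds volume hV).ne' h1
  intro Z Y hZ hY hcov hZne hYne
  by_contra hemp
  rw [Set.not_nonempty_iff_eq_empty] at hemp
  let T : Set (Euc N) → Set (Euc N) := fun Z => {x | ∃ V, IsOpen V ∧ x ∈ V ∧ V ⊆ Ω ∧ V \ Γ ⊆ Z}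
  have hTo : ∀ Z, IsOpen (T Z) := by
    intro Z
    rw [isOpen_iff_mem_nhds]
    rintro x ⟨V, hV, hxV, h1, h2⟩
    exact Filter.mem_of_superset (hV.mem_nhds hxV) fun y hy => ⟨V, hV, hy, h1, h2⟩
  have hin : ∀ Z, IsOpen Z → (Ω \ Γ) ∩ Z ⊆ T Z := by
    rintro Z hZ x ⟨⟨h1, h2⟩, h3⟩
    exact ⟨Ω ∩ Z, hΩo.inter hZ, ⟨h1, h3⟩, Set.inter_subset_left,
      fun y hy => hy.1.2⟩
  have hcov' : Ω ⊆ T Z ∪ T Y := by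
    intro x hx
    by_cases hxΓ : x ∈ Γ
    · obtain ⟨V, hV, hxV, hVO, hVc⟩ := local_conn hk hΓ hxΓ hΩo hx
      have hsub : V \ Γ ⊆ Z ∪ Y := fun y hy => hcov ⟨hVO hy.1, hy.2⟩
      have hdis : V \ Γ ∩ (Z ∩ Y) = ∅ := by
        rw [Set.eq_empty_iff_forall_notMem]
        rintro y ⟨hy, hy'⟩
        have : y ∈ Ω \ Γ ∩ (Z ∩ Y) := ⟨⟨hVO hy.1, hy.2⟩, hy'⟩
        rw [hemp] at this
        exact this
      by_cases hZV : ((V \ Γ) ∩ Z).Nonempty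
      · by_cases hYV : ((V \ Γ) ∩ Y).Nonempty
        · have := hVc Z Y hZ hY hsub hZV hYV
          rw [hdis] at this
          exact absurd this Set.not_nonempty_empty
        · refine Or.inl ⟨V, hV, hxV, hVO, fun y hy => ?_⟩
          rcases hsub hy with h | h
          · exact h
          · exact absurd ⟨y, hy, h⟩ hYV
      · refine Or.inr ⟨V, hV, hxV, hVO, fun y hy => ?_⟩
        rcases hsub hy with h | h
        · exact absurd ⟨y, hy, h⟩ hZV
        · exact h
    · rcases hcov ⟨hx, hxΓ⟩ with h | h
      · exact Or.inl (hin Z hZ ⟨⟨hx, hxΓ⟩, h⟩)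
      · exact Or.inr (hin Y hY ⟨⟨hx, hxΓ⟩, h⟩)
  obtain ⟨x, hx, hx1, hx2⟩ := hΩ (T Z) (T Y) (hTo Z) (hTo Y) hcov'
    (by obtain ⟨z, hz⟩ := hZne; exact ⟨z, hz.1.1, hin Z hZ hz⟩)
    (by obtain ⟨z, hz⟩ := hYne; exact ⟨z, hz.1.1, hin Y hY hz⟩)
  obtain ⟨V1, hV1, hxV1, hΩ1, hs1⟩ := hx1
  obtain ⟨V2, hV2, hxV2, hΩ2, hs2⟩ := hx2
  obtain ⟨y, hy, hyΓ⟩ := hIntg x (V1 ∩ V2) ((hV1.inter hV2).mem_nhds ⟨hxV1, hxV2⟩)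
  have : y ∈ Ω \ Γ ∩ (Z ∩ Y) := ⟨⟨hΩ1 hy.1, hyΓ⟩, hs1 ⟨hy.1, hyΓ⟩, hs2 ⟨hy.2, hyΓ⟩⟩
  rw [hemp] at this
  exact this



def hker (t : ℝ) : ℝ := expNegInvGlue (1 - t)
def Gker (t : ℝ) : ℝ := ∫ s in t..1, hker s

lemma hker_cd : ContDiff ℝ (⊤ : ℕ∞) hker :=
  expNegInvGlue.contDiff.comp (contDiff_const.sub contDiff_id)

lemma hker_cont : Continuous hker := hker_cd.continuous

lemma hker_nonneg (t : ℝ) : 0 ≤ hker t := expNegInvGlue.nonneg _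

lemma hker_le_one (t : ℝ) : hker t ≤ 1 := by
  unfold hker expNegInvGlue
  split_ifs with h
  · norm_num
  · push Not at h
    rw [Real.exp_le_one_iff]
    have := inv_pos.2 h
    linarith

lemma hker_zero {t : ℝ} (ht : 1 ≤ t) : hker t = 0 := expNegInvGlue.zero_of_nonpos (by linarith)

lemma hker_pos {t : ℝ} (ht : t < 1) : 0 < hker t := expNegInvGlue.pos_of_pos (by linarith)

lemma hker_anti {s t : ℝ} (h : s ≤ t) : hker t ≤ hker s := by
  unfold hker
  exact expNegInvGlue.monotone (by linarith)

lemma Gker_deriv (t : ℝ) : HasDerivAt Gker (-hker t) t :=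
  intervalIntegral.integral_hasDerivAt_left (hker_cont.intervalIntegrable _ _)
    (hker_cont.stronglyMeasurableAtFilter _ _) hker_cont.continuousAt

lemma Gker_cd : ContDiff ℝ (⊤ : ℕ∞) Gker := by
  rw [contDiff_infty_iff_deriv]
  refine ⟨fun t => (Gker_deriv t).differentiableAt, ?_⟩
  have : deriv Gker = fun t => -hker t := by ext t; exact (Gker_deriv t).deriv
  rw [this]; exact hker_cd.neg

lemma Gker_zero {t : ℝ} (ht : 1 ≤ t) : Gker t = 0 := by
  unfold Gker
  rw [intervalIntegral.integral_symm, neg_eq_zero]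
  rw [intervalIntegral.integral_congr (g := fun _ => 0)]
  · simp
  · intro s hs
    rw [Set.uIcc_of_le ht] at hs
    exact hker_zero hs.1

lemma Gker_nonneg (t : ℝ) : 0 ≤ Gker t := by
  by_cases h : t ≤ 1
  · exact intervalIntegral.integral_nonneg h fun s _ => hker_nonneg s
  · rw [Gker_zero (by linarith)]

lemma hker_deriv_bdd : ∃ B > (0:ℝ), ∀ t, 0 ≤ t → |t * deriv hker t| ≤ B := by
  have hc : Continuous (fun t => t * deriv hker t) :=
    continuous_id.mul (hker_cd.continuous_deriv (by simp))
  obtain ⟨B, hB⟩ := (isCompact_Icc (a := (0:ℝ)) (b := 1)).exists_bound_of_continuousOn hc.continuousOn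
  refine ⟨max B 1, by positivity, fun t ht => ?_⟩
  by_cases h : t ≤ 1
  · exact (hB t ⟨ht, h⟩).trans (le_max_left _ _)
  · have : deriv hker t = 0 := by
      have : hker =ᶠ[𝓝 t] fun _ => 0 := by
        filter_upwards [lt_mem_nhds (not_le.1 h)] with s hs using hker_zero hs.le
      rw [this.deriv_eq]; simp
    rw [this]; simp

lemma nu_singleton {N : ℕ} (y : Euc N) : nu {y} = fun _ => y := by
  ext1 x
  exact (nu_spec isCompact_singleton (Set.singleton_nonempty y) x).1

lemma distG_singleton {N : ℕ} (y : Euc N) :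
    (fun x => distG {y} x ^ 2) = fun x => ‖x - y‖ ^ 2 := by
  ext x; simp [distG, dist_eq_norm]

lemma lap_normsq {N : ℕ} (x y : Euc N) : lap (fun x => ‖x - y‖ ^ 2) x = 2 * N := by
  have := rho_lap (Γ := {y}) (x := x) isCompact_singleton (Set.singleton_nonempty y)
    (by rw [nu_singleton]; exact contDiffAt_const)
  rw [distG_singleton, nu_singleton] at this
  simpa using this

lemma gdot_normsq {N : ℕ} (x y : Euc N) :
    gdot (fun x => ‖x - y‖ ^ 2) (fun x => ‖x - y‖ ^ 2) x = 4 * ‖x - y‖ ^ 2 := by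
  have := rho_gdot (Γ := {y}) (x := x) isCompact_singleton (Set.singleton_nonempty y)
    (by rw [nu_singleton]; exact differentiableAt_const _)
  rw [distG_singleton] at this
  rw [this, congrFun (distG_singleton y) x]

/-- the radial test function -/
def Gt {N : ℕ} (y : Euc N) (ε : ℝ) (x : Euc N) : ℝ := Gker (‖x - y‖ ^ 2 / ε ^ 2)

lemma Gt_cd {N : ℕ} (y : Euc N) (ε : ℝ) : ContDiff ℝ (⊤ : ℕ∞) (Gt y ε) :=
  Gker_cd.comp (((contDiff_id.sub contDiff_const).norm_sq ℝ).div_const _)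

lemma Gt_lap {N : ℕ} (y x : Euc N) {ε : ℝ} (hε : ε ≠ 0) :
    lap (Gt y ε) x = -hker (‖x - y‖ ^ 2 / ε ^ 2) / ε ^ 2 * (2 * N)
      + (-deriv hker (‖x - y‖ ^ 2 / ε ^ 2) / ε ^ 4) * (4 * ‖x - y‖ ^ 2) := by
  have h1 : ∀ t, HasDerivAt (fun t => Gker (t / ε ^ 2)) (-hker (t / ε ^ 2) / ε ^ 2) t := by
    intro t
    have h := (Gker_deriv (t / ε ^ 2)).comp t ((hasDerivAt_id t).div_const (ε ^ 2))
    refine HasDerivAt.congr_deriv h ?_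
    ring
  have h2 : HasDerivAt (fun t => -hker (t / ε ^ 2) / ε ^ 2)
      (-deriv hker (‖x - y‖ ^ 2 / ε ^ 2) / ε ^ 4) (‖x - y‖ ^ 2) := by
    have h0 : HasDerivAt hker (deriv hker (‖x - y‖ ^ 2 / ε ^ 2)) (‖x - y‖ ^ 2 / ε ^ 2) :=
      (hker_cd.differentiable (by simp) _).hasDerivAt
    have h := ((h0.comp (‖x - y‖ ^ 2) ((hasDerivAt_id _).div_const (ε ^ 2))).neg).div_const (ε ^ 2)
    refine HasDerivAt.congr_deriv h ?_
    field_simp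
  have := lap_comp (φ := fun x => ‖x - y‖ ^ 2) (x := x)
    (((contDiff_id.sub contDiff_const).norm_sq ℝ).contDiffAt) (Eventually.of_forall h1) h2
  rw [lap_normsq, gdot_normsq] at this
  exact this

lemma Gt_tsupport {N : ℕ} (y : Euc N) {ε : ℝ} (hε : 0 < ε) :
    tsupport (Gt y ε) ⊆ closedBall y ε := by
  refine closure_minimal ?_ isClosed_closedBall
  intro x hx
  by_contra h
  apply hx
  refine Gker_zero ?_
  rw [mem_closedBall, dist_eq_norm, not_le] at h
  rw [le_div_iff₀ (by positivity), one_mul]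
  exact pow_le_pow_left₀ hε.le h.le 2

lemma Gt_test {N : ℕ} {O : Set (Euc N)} (y : Euc N) {ε : ℝ} (hε : 0 < ε)
    (h : closedBall y ε ⊆ O) : IsTestFun O (Gt y ε) :=
  ⟨Gt_cd y ε, HasCompactSupport.of_support_subset_isCompact (isCompact_closedBall y ε)
    (subset_closure.trans (Gt_tsupport y hε)), (Gt_tsupport y hε).trans h⟩

lemma lap_zero_off {N : ℕ} {φ : Euc N → ℝ} {x : Euc N} (hx : x ∉ tsupport φ) : lap φ x = 0 := by
  have : φ =ᶠ[𝓝 x] fun _ => 0 := notMem_tsupport_iff_eventuallyEq.1 hx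
  rw [lap_congr this, lap_eq]
  simp

/-- the kernel average -/
def Fav {N : ℕ} (u : Euc N → ℝ) (y : Euc N) (ε : ℝ) : ℝ :=
  ∫ x, u x * ((ε ^ N)⁻¹ * hker (‖x - y‖ ^ 2 / ε ^ 2))

lemma Fav_deriv {N : ℕ} {u : Euc N → ℝ} (hu : Integrable u) (y : Euc N) {ε : ℝ} (hε : 0 < ε) :
    HasDerivAt (Fav u y) (1 / 2 * ε * (ε ^ N)⁻¹ * ∫ x, u x * lap (Gt y ε) x) ε := by
  obtain ⟨B, hB, hBd⟩ := hker_deriv_bdd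
  have hcont : ∀ e, Continuous fun x : Euc N => ((e ^ N)⁻¹ * hker (‖x - y‖ ^ 2 / e ^ 2)) := by
    intro e
    exact continuous_const.mul (hker_cont.comp (by fun_prop))
  have hlapb : ∀ e, 0 < e → ∀ x, |lap (Gt y e) x| ≤ (2 * N + 4 * B) / e ^ 2 := by
    intro e he x
    rw [Gt_lap y x he.ne']
    have h1 := hBd (‖x - y‖ ^ 2 / e ^ 2) (by positivity)
    have h2 := hker_nonneg (‖x - y‖ ^ 2 / e ^ 2)
    have h3 := hker_le_one (‖x - y‖ ^ 2 / e ^ 2)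
    have heq : -hker (‖x - y‖ ^ 2 / e ^ 2) / e ^ 2 * (2 * N)
      + (-deriv hker (‖x - y‖ ^ 2 / e ^ 2) / e ^ 4) * (4 * ‖x - y‖ ^ 2) =
      -(hker (‖x - y‖ ^ 2 / e ^ 2) * (2 * N) + 4 *
        (‖x - y‖ ^ 2 / e ^ 2 * deriv hker (‖x - y‖ ^ 2 / e ^ 2))) / e ^ 2 := by
      field_simp
      ring
    rw [heq, abs_div, abs_neg, abs_of_pos (show 0 < e ^ 2 by positivity)]
    gcongr
    refine (abs_add_le _ _).trans ?_
    rw [abs_mul (hker _), abs_mul 4, abs_of_nonneg h2]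
    have hN : |(2 * N : ℝ)| = 2 * N := abs_of_nonneg (by positivity)
    rw [hN, abs_of_pos (show (0:ℝ) < 4 by norm_num)]
    have : hker (‖x - y‖ ^ 2 / e ^ 2) * (2 * N) ≤ 1 * (2 * N) := by gcongr
    linarith
  have hlapc : ∀ e, Continuous (lap (Gt y e)) := by
    intro e
    rw [continuous_iff_continuousAt]
    intro x
    exact continuousAt_lap ((Gt_cd y e).contDiffAt.of_le (WithTop.coe_le_coe.2 (le_top : (2:ℕ∞) ≤ ⊤)))
  have key := hasDerivAt_integral_of_dominated_loc_of_deriv_le (μ := volume) (x₀ := ε)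
    (s := Set.Ioo (ε / 2) (2 * ε))
    (F := fun e x => u x * ((e ^ N)⁻¹ * hker (‖x - y‖ ^ 2 / e ^ 2)))
    (F' := fun e x => u x * (1 / 2 * e * (e ^ N)⁻¹ * lap (Gt y e) x))
    (bound := fun x => ‖u x‖ * (1 / 2 * (2 * ε) * ((ε / 2) ^ N)⁻¹ * ((2 * N + 4 * B) / (ε / 2) ^ 2)))
    (Ioo_mem_nhds (by linarith) (by linarith))
    (Eventually.of_forall fun e => hu.aestronglyMeasurable.mul (hcont e).aestronglyMeasurable)
    (by
      refine hu.mul_bdd (c := (ε ^ N)⁻¹) (hcont ε).aestronglyMeasurable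
        (Eventually.of_forall fun x => ?_)
      rw [Real.norm_eq_abs, abs_of_nonneg (mul_nonneg (by positivity) (hker_nonneg _))]
      exact mul_le_of_le_one_right (by positivity) (hker_le_one _))
    (hu.aestronglyMeasurable.mul (continuous_const.mul (hlapc ε)).aestronglyMeasurable)
    (Eventually.of_forall fun x e he => ?_)
    (hu.norm.mul_const _)
    (Eventually.of_forall fun x e he => ?_)
  · have := key.2
    refine HasDerivAt.congr_deriv this ?_
    rw [← integral_const_mul]
    congr 1; ext x; ring
  · have he0 : 0 < e := by have := he.1; linarith
    rw [norm_mul]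
    gcongr
    rw [Real.norm_eq_abs, abs_mul, abs_of_nonneg (show 0 ≤ 1 / 2 * e * (e ^ N)⁻¹ by positivity)]
    have h1 := he.1.le
    have h2 := he.2.le
    have h3 := hlapb e he0 x
    have h4 : (2 * N + 4 * B) / e ^ 2 ≤ (2 * N + 4 * B) / (ε / 2) ^ 2 := by gcongr
    have h5 : 1 / 2 * e * (e ^ N)⁻¹ ≤ 1 / 2 * (2 * ε) * ((ε / 2) ^ N)⁻¹ := by gcongr
    exact mul_le_mul h5 (h3.trans h4) (abs_nonneg _) (by positivity)
  · have he0 : 0 < e := by have := he.1; linarith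
    refine HasDerivAt.const_mul (u x) ?_
    rw [Gt_lap y x he0.ne']
    have h0 : HasDerivAt hker (deriv hker (‖x - y‖ ^ 2 / e ^ 2)) (‖x - y‖ ^ 2 / e ^ 2) :=
      (hker_cd.differentiable (by simp) _).hasDerivAt
    have h1 : HasDerivAt (fun e : ℝ => ‖x - y‖ ^ 2 / e ^ 2) (-2 * ‖x - y‖ ^ 2 / e ^ 3) e := by
      have := ((hasDerivAt_pow 2 e).inv (by positivity)).const_mul (‖x - y‖ ^ 2)
      refine HasDerivAt.congr_deriv this ?_
      field_simp
      norm_num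
      ring
    have h2 : HasDerivAt (fun e : ℝ => (e ^ N)⁻¹) (-N * (e ^ N)⁻¹ / e) e := by
      have := (hasDerivAt_pow N e).inv (by positivity)
      refine HasDerivAt.congr_deriv this ?_
      rcases N with _ | n
      · simp
      · simp only [Nat.add_sub_cancel]
        field_simp
        ring
    have h3 := h2.mul (h0.comp e h1)
    refine HasDerivAt.congr_deriv h3 ?_
    simp only [Function.comp]
    field_simp
    ring

lemma Fav_anti {N : ℕ} {u : Euc N → ℝ} (hu : Integrable u) (y : Euc N) {R : ℝ}
    (hs : ∀ ε, 0 < ε → ε ≤ R → ∫ x, u x * lap (Gt y ε) x ≤ 0) {ε : ℝ} (hε : 0 < ε) (hR : ε ≤ R) :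
    Fav u y R ≤ Fav u y ε := by
  have := antitoneOn_of_deriv_nonpos (convex_Icc ε R) (f := Fav u y)
    (fun e he => (Fav_deriv hu y (hε.trans_le he.1)).continuousAt.continuousWithinAt)
    (fun e he => by
      rw [interior_Icc] at he
      exact (Fav_deriv hu y (hε.trans he.1)).differentiableAt.differentiableWithinAt)
    (fun e he => by
      rw [interior_Icc] at he
      have he0 := hε.trans he.1
      rw [(Fav_deriv hu y he0).deriv]
      exact mul_nonpos_of_nonneg_of_nonpos (by positivity) (hs e he0 he.2.le))
  exact this ⟨le_rfl, hR⟩ ⟨hR, le_rfl⟩ hR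

/-- bound of the kernel average by the ball average -/
lemma Fav_le {N : ℕ} {u : Euc N → ℝ} (hu : Integrable u) (y : Euc N) {ε : ℝ} (hε : 0 < ε) :
    Fav u y ε ≤ volume.real (ball (0 : Euc N) 1) * ⨍ x in closedBall y ε, ‖u x‖ := by
  have hvol : volume.real (closedBall y ε) = ε ^ N * volume.real (ball (0 : Euc N) 1) := by
    rw [measureReal_def, Measure.addHaar_closedBall _ _ hε.le, ENNReal.toReal_mul,
      ENNReal.toReal_ofReal (by positivity), finrank_euclideanSpace_fin, measureReal_def]
  have hpos : 0 < volume.real (ball (0 : Euc N) 1) :=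
    ENNReal.toReal_pos (measure_ball_pos _ _ one_pos).ne' measure_ball_lt_top.ne
  rw [setAverage_eq, hvol, smul_eq_mul]
  have : volume.real (ball (0 : Euc N) 1) * ((ε ^ N * volume.real (ball (0 : Euc N) 1))⁻¹ *
      ∫ x in closedBall y ε, ‖u x‖) = ∫ x in closedBall y ε, ‖u x‖ * (ε ^ N)⁻¹ := by
    rw [integral_mul_const]
    field_simp
  rw [this, ← integral_indicator measurableSet_closedBall]
  unfold Fav
  by_cases hIntg : Integrable (fun x => u x * ((ε ^ N)⁻¹ * hker (‖x - y‖ ^ 2 / ε ^ 2)))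
  · refine integral_mono hIntg ?_ fun x => ?_
    · exact (hu.norm.mul_const _).indicator measurableSet_closedBall
    · by_cases hx : x ∈ closedBall y ε
      · rw [Set.indicator_of_mem hx]
        refine mul_le_mul (le_abs_self _) (mul_le_of_le_one_right (by positivity) (hker_le_one _))
          (mul_nonneg (by positivity) (hker_nonneg _)) (norm_nonneg _)
      · rw [Set.indicator_of_notMem hx]
        dsimp only
        rw [hker_zero, mul_zero, mul_zero]
        rw [mem_closedBall, dist_eq_norm, not_le] at hx
        rw [le_div_iff₀ (by positivity), one_mul]
        exact pow_le_pow_left₀ hε.le hx.le 2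
  · rw [integral_undef hIntg]
    exact integral_nonneg fun x => Set.indicator_nonneg (fun x _ => by positivity) x



/-- the pointwise mean value inequality -/
lemma mean_value {N : ℕ} {O : Set (Euc N)} (hO : IsOpen O) {u : Euc N → ℝ}
    (hu0 : ∀ᵐ x ∂volume, x ∈ O → 0 ≤ u x) (hloc : LocallyIntegrableOn u O volume)
    (hsup : ∀ φ, IsTestFun O φ → (∀ x, 0 ≤ φ x) → ∫ x in O, u x * lap φ x ≤ 0)
    {y₀ : Euc N} {R : ℝ} (hR : 0 < R) (hball : closedBall y₀ (2 * R) ⊆ O) :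
    ∀ᵐ y ∂volume, y ∈ ball y₀ (R / 4) →
      (R ^ N)⁻¹ * hker (9 / 16) * ∫ x in ball y₀ (R / 2), u x ≤
        volume.real (ball (0 : Euc N) 1) * u y := by
  set u1 : Euc N → ℝ := (closedBall y₀ (2 * R)).indicator u with hu1
  have hIntg : Integrable u1 := by
    rw [hu1, integrable_indicator_iff measurableSet_closedBall]
    exact hloc.integrableOn_compact_subset hball (isCompact_closedBall _ _)
  have hnn : ∀ᵐ x ∂volume, 0 ≤ u1 x := by
    filter_upwards [hu0] with x hx
    exact Set.indicator_apply_nonneg fun h => hx (hball h)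
  have hL := IsUnifLocDoublingMeasure.ae_tendsto_average (volume : Measure (Euc N))
    (f := fun x => ‖u1 x‖) hIntg.norm.locallyIntegrable 1
  filter_upwards [hL, hnn] with y hy hy0 hyb
  have hsub : closedBall y R ⊆ closedBall y₀ (2 * R) := by
    refine closedBall_subset_closedBall' ?_
    have := mem_ball.1 hyb
    linarith
  have hyin : y ∈ closedBall y₀ (2 * R) := hsub (mem_closedBall_self hR.le)
  have hu1y : u1 y = u y := Set.indicator_of_mem hyin u
  have hs : ∀ ε, 0 < ε → ε ≤ R → ∫ x, u1 x * lap (Gt y ε) x ≤ 0 := by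
    intro ε hε hεR
    have hcb : closedBall y ε ⊆ closedBall y₀ (2 * R) :=
      (closedBall_subset_closedBall hεR).trans hsub
    have h1 := hsup (Gt y ε) (Gt_test y hε (hcb.trans hball)) fun x => Gker_nonneg _
    rw [← integral_indicator hO.measurableSet] at h1
    refine le_trans (le_of_eq ?_) h1
    congr 1; ext x
    by_cases hx : x ∈ closedBall y₀ (2 * R)
    · rw [Set.indicator_of_mem (hball hx), hu1, Set.indicator_of_mem hx]
    · have hz : lap (Gt y ε) x = 0 := lap_zero_off fun h => hx (hcb (Gt_tsupport y hε h))
      rw [hu1, Set.indicator_of_notMem hx, zero_mul]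
      by_cases hxO : x ∈ O
      · rw [Set.indicator_of_mem hxO, hz, mul_zero]
      · rw [Set.indicator_of_notMem hxO]
  have hlim := hy (l := 𝓝[>] (0:ℝ)) (fun _ => y) id tendsto_id (by
    filter_upwards [self_mem_nhdsWithin] with e he
    exact mem_closedBall_self (by simpa using (le_of_lt he)))
  have hFle : Fav u1 y R ≤ volume.real (ball (0 : Euc N) 1) * ‖u1 y‖ := by
    refine ge_of_tendsto (hlim.const_mul _) ?_
    filter_upwards [Ioc_mem_nhdsGT hR] with e he
    exact (Fav_anti hIntg y hs he.1 he.2).trans (Fav_le hIntg y he.1)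
  rw [Real.norm_of_nonneg hy0, hu1y] at hFle
  refine le_trans ?_ hFle
  unfold Fav
  rw [← integral_indicator measurableSet_ball, ← integral_const_mul]
  have hlt : ball y₀ (R / 2) ⊆ closedBall y₀ (2 * R) :=
    ball_subset_closedBall.trans (closedBall_subset_closedBall (by linarith))
  have hiu : IntegrableOn u (ball y₀ (R / 2)) :=
    (hloc.integrableOn_compact_subset hball (isCompact_closedBall _ _)).mono_set hlt
  refine integral_mono_ae ((hiu.integrable_indicator measurableSet_ball).const_mul _) ?_ ?_
  · refine hIntg.mul_bdd (c := (R ^ N)⁻¹) ?_ (Eventually.of_forall fun x => ?_)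
    · exact (continuous_const.mul (hker_cont.comp (by fun_prop))).aestronglyMeasurable
    · rw [Real.norm_eq_abs, abs_of_nonneg (mul_nonneg (by positivity) (hker_nonneg _))]
      exact mul_le_of_le_one_right (by positivity) (hker_le_one _)
  · filter_upwards [hnn] with x hx
    by_cases hxb : x ∈ ball y₀ (R / 2)
    · rw [Set.indicator_of_mem hxb]
      have h1 : u1 x = u x := Set.indicator_of_mem (hlt hxb) u
      rw [h1] at hx ⊢
      have h2 : ‖x - y‖ ≤ 3 / 4 * R := by
        rw [← dist_eq_norm]
        have := dist_triangle x y₀ y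
        have h3 := mem_ball.1 hxb
        have h4 := mem_ball'.1 hyb
        linarith
      have h3 : ‖x - y‖ ^ 2 / R ^ 2 ≤ 9 / 16 := by
        rw [div_le_iff₀ (by positivity)]
        have := pow_le_pow_left₀ (norm_nonneg _) h2 2
        nlinarith
      have h4 := hker_anti h3
      have h5 : (R ^ N)⁻¹ * hker (9 / 16) ≤ (R ^ N)⁻¹ * hker (‖x - y‖ ^ 2 / R ^ 2) :=
        mul_le_mul_of_nonneg_left h4 (by positivity)
      rw [mul_comm]
      exact mul_le_mul_of_nonneg_left h5 hx
    · rw [Set.indicator_of_notMem hxb, mul_zero]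
      exact mul_nonneg hx (mul_nonneg (by positivity) (hker_nonneg _))

lemma dichotomy {N : ℕ} {O : Set (Euc N)} (hO : IsOpen O) {u : Euc N → ℝ}
    (hu0 : ∀ᵐ x ∂volume, x ∈ O → 0 ≤ u x) (hloc : LocallyIntegrableOn u O volume)
    (hsup : ∀ φ, IsTestFun O φ → (∀ x, 0 ≤ φ x) → ∫ x in O, u x * lap φ x ≤ 0)
    {y₀ : Euc N} (hy₀ : y₀ ∈ O) :
    (∃ r > 0, ball y₀ r ⊆ O ∧ ∀ᵐ x ∂volume, x ∈ ball y₀ r → u x = 0) ∨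
    (∃ r > 0, ball y₀ r ⊆ O ∧ ∃ c > 0, ∀ᵐ x ∂volume, x ∈ ball y₀ r → c ≤ u x) := by
  obtain ⟨R', hR', hb'⟩ := Metric.nhds_basis_closedBall.mem_iff.1 (hO.mem_nhds hy₀)
  set R := R' / 2 with hRdef
  have hR : 0 < R := by positivity
  have hball : closedBall y₀ (2 * R) ⊆ O := by rwa [hRdef, mul_div_cancel₀ _ two_ne_zero]
  have hlt : ∀ r, r ≤ 2 * R → ball y₀ r ⊆ O := fun r hr =>
    (ball_subset_closedBall.trans (closedBall_subset_closedBall hr)).trans hball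
  have hiu : IntegrableOn u (ball y₀ (R / 2)) :=
    (hloc.integrableOn_compact_subset hball (isCompact_closedBall _ _)).mono_set
      (ball_subset_closedBall.trans (closedBall_subset_closedBall (by linarith)))
  have hnn : 0 ≤ᵐ[volume.restrict (ball y₀ (R / 2))] u := by
    rw [EventuallyLE, ae_restrict_iff' measurableSet_ball]
    filter_upwards [hu0] with x hx h
    exact hx (hlt _ (by linarith) h)
  by_cases h : ∫ x in ball y₀ (R / 2), u x = 0
  · left
    refine ⟨R / 2, by positivity, hlt _ (by linarith), ?_⟩
    rw [setIntegral_eq_zero_iff_of_nonneg_ae hnn hiu, EventuallyEq,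
      ae_restrict_iff' measurableSet_ball] at h
    exact h
  · right
    have hpos : 0 < ∫ x in ball y₀ (R / 2), u x :=
      lt_of_le_of_ne (integral_nonneg_of_ae hnn) (Ne.symm h)
    have hv : 0 < volume.real (ball (0 : Euc N) 1) :=
      ENNReal.toReal_pos (measure_ball_pos _ _ one_pos).ne' measure_ball_lt_top.ne
    have hk : 0 < hker (9 / 16) := hker_pos (by norm_num)
    refine ⟨R / 4, by positivity, hlt _ (by linarith),
      (R ^ N)⁻¹ * hker (9 / 16) * (∫ x in ball y₀ (R / 2), u x) / volume.real (ball (0 : Euc N) 1),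
      by positivity, ?_⟩
    filter_upwards [mean_value hO hu0 hloc hsup hR hball] with x hx hxb
    rw [div_le_iff₀ hv, mul_comm (u x)]
    exact hx hxb

lemma positivity_compact {N : ℕ} {O : Set (Euc N)} (hO : IsOpen O) (hpre : IsPreconnected O)
    {u : Euc N → ℝ}
    (hu0 : ∀ᵐ x ∂volume, x ∈ O → 0 ≤ u x) (hunt : ¬ ∀ᵐ x ∂volume, x ∈ O → u x = 0)
    (hloc : LocallyIntegrableOn u O volume)
    (hsup : ∀ φ, IsTestFun O φ → (∀ x, 0 ≤ φ x) → ∫ x in O, u x * lap φ x ≤ 0)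
    {K : Set (Euc N)} (hK : IsCompact K) (hKO : K ⊆ O) :
    ∃ c > (0:ℝ), ∀ᵐ x ∂volume, x ∈ K → c ≤ u x := by
  set Z : Set (Euc N) := {y | ∃ V, IsOpen V ∧ y ∈ V ∧ V ⊆ O ∧ ∀ᵐ x ∂volume, x ∈ V → u x = 0} with hZ
  set Y : Set (Euc N) :=
    {y | ∃ V, IsOpen V ∧ y ∈ V ∧ V ⊆ O ∧ ∃ c > 0, ∀ᵐ x ∂volume, x ∈ V → c ≤ u x} with hY
  have hZo : IsOpen Z := by
    rw [isOpen_iff_mem_nhds]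
    rintro x ⟨V, hV, hxV, h⟩
    exact Filter.mem_of_superset (hV.mem_nhds hxV) fun y hy => ⟨V, hV, hy, h⟩
  have hYo : IsOpen Y := by
    rw [isOpen_iff_mem_nhds]
    rintro x ⟨V, hV, hxV, h⟩
    exact Filter.mem_of_superset (hV.mem_nhds hxV) fun y hy => ⟨V, hV, hy, h⟩
  have hcov : O ⊆ Z ∪ Y := by
    intro y hy
    rcases dichotomy hO hu0 hloc hsup hy with ⟨r, hr, hb, h⟩ | ⟨r, hr, hb, h⟩
    · exact Or.inl ⟨_, isOpen_ball, mem_ball_self hr, hb, h⟩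
    · exact Or.inr ⟨_, isOpen_ball, mem_ball_self hr, hb, h⟩
  have hdis : ¬ (O ∩ (Z ∩ Y)).Nonempty := by
    rintro ⟨y, -, ⟨V, hV, hyV, -, h⟩, ⟨V', hV', hyV', -, c, hc, h'⟩⟩
    have h0 : volume (V ∩ V') = 0 := by
      rw [measure_eq_zero_iff_ae_notMem]
      filter_upwards [h, h'] with x hx hx' hh
      have h1 := hx hh.1
      have h2 := hx' hh.2
      linarith
    exact (Measure.measure_pos_of_mem_nhds volume ((hV.inter hV').mem_nhds ⟨hyV, hyV'⟩)).ne' h0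
  have hYne : (O ∩ Y).Nonempty := by
    by_contra hne
    apply hunt
    have hOZ : O ⊆ Z := fun y hy => (hcov hy).resolve_right fun h => hne ⟨y, hy, h⟩
    have h0 : volume {x | x ∈ O ∧ u x ≠ 0} = 0 := by
      refine measure_null_of_locally_null _ ?_
      rintro y ⟨hy, -⟩
      obtain ⟨V, hV, hyV, hVO, h⟩ := hOZ hy
      refine ⟨V ∩ {x | x ∈ O ∧ u x ≠ 0}, inter_mem (mem_nhdsWithin_of_mem_nhds (hV.mem_nhds hyV))
        self_mem_nhdsWithin, ?_⟩
      rw [measure_eq_zero_iff_ae_notMem]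
      filter_upwards [h] with x hx hh
      exact hh.2.2 (hx hh.1)
    rw [measure_eq_zero_iff_ae_notMem] at h0
    filter_upwards [h0] with x hx hxO
    by_contra hu
    exact hx ⟨hxO, hu⟩
  have hZe : ¬ (O ∩ Z).Nonempty := fun hne => hdis (hpre Z Y hZo hYo hcov hne hYne)
  have hOY : O ⊆ Y := fun y hy => (hcov hy).resolve_left fun h => hZe ⟨y, hy, h⟩
  refine hK.induction_on (p := fun s => ∃ c > (0:ℝ), ∀ᵐ x ∂volume, x ∈ s → c ≤ u x)
    ⟨1, one_pos, by simp⟩ ?_ ?_ ?_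
  · rintro s t hst ⟨c, hc, h⟩
    exact ⟨c, hc, h.mono fun x hx hxs => hx (hst hxs)⟩
  · rintro s t ⟨c, hc, h⟩ ⟨d, hd, h'⟩
    refine ⟨min c d, lt_min hc hd, ?_⟩
    filter_upwards [h, h'] with x hx hx' hxs
    rcases hxs with hh | hh
    · exact (min_le_left _ _).trans (hx hh)
    · exact (min_le_right _ _).trans (hx' hh)
  · intro x hx
    obtain ⟨V, hV, hxV, -, c, hc, h⟩ := hOY (hKO hx)
    exact ⟨V, mem_nhdsWithin_of_mem_nhds (hV.mem_nhds hxV), c, hc, h⟩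



lemma lap_reflect {N : ℕ} {g : Euc N → ℝ} (hg : ContDiff ℝ (⊤ : ℕ∞) g) (x t : Euc N) :
    lap (fun t => g (x - t)) t = lap g (x - t) := by
  have h1 : (fun t => g (x - t)) = fun t => (fun z => g ((-1 : ℝ) • z)) (t - x) := by
    ext t; simp
  unfold lap
  rw [h1]
  refine Finset.sum_congr rfl fun i _ => ?_
  rw [iteratedFDeriv_comp_sub (f := fun z => g ((-1 : ℝ) • z)), iteratedFDeriv_comp_const_smul (i := 2) (-1 : ℝ)
    (hg.of_le (WithTop.coe_le_coe.2 (le_top : (2:ℕ∞) ≤ ⊤)))]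
  simp

lemma conv_fderiv {N : ℕ} {u g : Euc N → ℝ} (hu : LocallyIntegrable u)
    (hg : ContDiff ℝ (⊤ : ℕ∞) g) (hc : HasCompactSupport g) (x e : Euc N) :
    fderiv ℝ (fun x => ∫ t, u t * g (x - t)) x e = ∫ t, u t * fderiv ℝ g (x - t) e := by
  have h := hc.hasFDerivAt_convolution_right (ContinuousLinearMap.lsmul ℝ ℝ) hu
    (hg.of_le (WithTop.coe_le_coe.2 (le_top : (1:ℕ∞) ≤ ⊤))) x
  have h2 := convolution_precompR_apply (ContinuousLinearMap.lsmul ℝ ℝ) hu (hc.fderiv ℝ)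
    (hg.continuous_fderiv (by simp)) x e
  have h3 : (fun x => ∫ t, u t * g (x - t)) =
    convolution u g (ContinuousLinearMap.lsmul ℝ ℝ) volume := rfl
  rw [h3, h.fderiv, h2]
  rfl

lemma conv_cd {N : ℕ} {u g : Euc N → ℝ} (hu : LocallyIntegrable u)
    (hg : ContDiff ℝ (⊤ : ℕ∞) g) (hc : HasCompactSupport g) :
    ContDiff ℝ (⊤ : ℕ∞) (fun x => ∫ t, u t * g (x - t)) :=
  hc.contDiff_convolution_right (ContinuousLinearMap.lsmul ℝ ℝ) hu hg

lemma conv_lap {N : ℕ} {u g : Euc N → ℝ} (hu : LocallyIntegrable u)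
    (hg : ContDiff ℝ (⊤ : ℕ∞) g) (hc : HasCompactSupport g) (x : Euc N) :
    lap (fun x => ∫ t, u t * g (x - t)) x = ∫ t, u t * lap g (x - t) := by
  have h2 : ∀ {f : Euc N → ℝ}, ContDiff ℝ (⊤ : ℕ∞) f → ∀ y e,
      fderiv ℝ (fderiv ℝ f) y e e = fderiv ℝ (fun z => fderiv ℝ f z e) y e := by
    intro f hf y e
    have := cd2_fderiv (φ := f) (x := y)
      (hf.contDiffAt.of_le (WithTop.coe_le_coe.2 (le_top : (2:ℕ∞) ≤ ⊤)))
    rw [fderiv_clm_apply this (differentiableAt_const _)]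
    simp
  have hgi : ∀ i, ContDiff ℝ (⊤ : ℕ∞) (fun z => fderiv ℝ g z (ev i)) := fun i =>
    (hg.fderiv_right (m := (⊤ : ℕ∞)) (by simp)).clm_apply contDiff_const
  have hci : ∀ i, HasCompactSupport (fun z => fderiv ℝ g z (ev i)) := fun i =>
    hc.fderiv_apply ℝ (ev i)
  have hcii : ∀ i, HasCompactSupport (fun z => fderiv ℝ (fun z => fderiv ℝ g z (ev i)) z (ev i)) :=
    fun i => (hci i).fderiv_apply ℝ (ev i)
  rw [lap_eq]
  simp only [lap_eq]
  have hIntg : ∀ i, Integrable fun t => u t * fderiv ℝ (fun z => fderiv ℝ g z (ev i)) (x - t) (ev i) := by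
    intro i
    exact (hcii i).convolutionExists_right (ContinuousLinearMap.lsmul ℝ ℝ) hu
      (((hgi i).continuous_fderiv (by simp)).clm_apply continuous_const) x
  have hR : (∫ t, u t * ∑ i, fderiv ℝ (fderiv ℝ g) (x - t) (ev i) (ev i)) =
      ∑ i, ∫ t, u t * fderiv ℝ (fun z => fderiv ℝ g z (ev i)) (x - t) (ev i) := by
    rw [← integral_finsetSum _ fun i _ => hIntg i]
    congr 1; ext t
    rw [Finset.mul_sum]
    refine Finset.sum_congr rfl fun i _ => ?_
    rw [h2 hg]
  rw [hR]
  refine Finset.sum_congr rfl fun i _ => ?_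
  rw [h2 (conv_cd hu hg hc)]
  have : (fun z => fderiv ℝ (fun x => ∫ t, u t * g (x - t)) z (ev i)) =
      fun z => ∫ t, u t * fderiv ℝ g (z - t) (ev i) := by
    ext z; exact conv_fderiv hu hg hc z _
  rw [this]
  exact conv_fderiv hu (hgi i) (hci i) x (ev i)

/-- A mollifier sequence. -/
lemma exists_mollifier (N : ℕ) : ∃ κ : ℕ → Euc N → ℝ, (∀ n, ContDiff ℝ (⊤ : ℕ∞) (κ n)) ∧
    (∀ n x, 0 ≤ κ n x) ∧ (∀ n, tsupport (κ n) ⊆ closedBall 0 (1 / (n + 1))) ∧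
    (∀ n, ∫ x, κ n x = 1) ∧ ∀ f : Euc N → ℝ, LocallyIntegrable f → ∀ᵐ x ∂volume,
      Tendsto (fun n => ∫ t, f t * κ n (x - t)) atTop (𝓝 (f x)) := by
  let φ : ℕ → ContDiffBump (0 : Euc N) := fun n =>
    ⟨1 / (n + 1) / 2, 1 / (n + 1), by positivity, by
      have : (0:ℝ) < 1 / (n + 1) := by positivity
      linarith⟩
  refine ⟨fun n => (φ n).normed volume, fun n => (φ n).contDiff_normed, fun n x => (φ n).nonneg_normed x,
    fun n => ((φ n).tsupport_normed_eq).subset, fun n => (φ n).integral_normed, fun f hf => ?_⟩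
  have := ContDiffBump.ae_convolution_tendsto_right_of_locallyIntegrable (φ := φ) (l := atTop) (K := 2)
    (g := f) (μ := volume) tendsto_one_div_add_atTop_nhds_zero_nat
    (Eventually.of_forall fun n => by simp only [φ]; linarith) hf
  filter_upwards [this] with x hx
  refine hx.congr fun n => ?_
  rw [convolution_eq_swap]
  congr 1; ext t
  simp [mul_comm]



/-- Averages of a function against a mollifier supported in a small ball are close to the value. -/
lemma moll_lower {N : ℕ} {K3 : Set (Euc N)} {f w κ : Euc N → ℝ}
    (hK3 : MeasurableSet K3)
    (hf : IntegrableOn f K3) (hκc : Continuous κ) (hκs : HasCompactSupport κ) (hκ0 : ∀ x, 0 ≤ κ x)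
    (hκ1 : ∫ x, κ x = 1) {x : Euc N} {ε η : ℝ}
    (hsup : ∀ z, κ z ≠ 0 → ‖z‖ ≤ ε) (hsub : closedBall x ε ⊆ K3)
    (hfw : ∀ᵐ t ∂volume, t ∈ closedBall x ε → w t ≤ f t)
    (hosc : ∀ t ∈ closedBall x ε, w x - η ≤ w t) :
    w x - η ≤ ∫ t, K3.indicator f t * κ (x - t) := by
  have hκi : Integrable κ := hκc.integrable_of_hasCompactSupport hκs
  have h1 : ∫ t, (w x - η) * κ (x - t) = w x - η := by
    rw [integral_const_mul, integral_sub_left_eq_self κ volume x, hκ1, mul_one]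
  rw [← h1]
  refine integral_mono_ae ((hκi.comp_sub_left x).const_mul _) ?_ ?_
  · obtain ⟨C, hC⟩ := hκs.exists_bound_of_continuous hκc
    exact (hf.integrable_indicator hK3).mul_bdd (c := C)
      (hκc.comp (continuous_const.sub continuous_id)).aestronglyMeasurable
      (Eventually.of_forall fun t => hC _)
  · filter_upwards [hfw] with t ht
    by_cases hz : κ (x - t) = 0
    · simp [hz]
    · have htb : t ∈ closedBall x ε := by
        rw [mem_closedBall', dist_eq_norm]; exact hsup _ hz
      rw [Set.indicator_of_mem (hsub htb)]
      exact mul_le_mul_of_nonneg_right ((hosc t htb).trans (ht htb)) (hκ0 _)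

lemma unif_osc {N : ℕ} {K3 : Set (Euc N)} (hK3 : IsCompact K3) {w : Euc N → ℝ}
    (hw : ContinuousOn w K3) {η : ℝ} (hη : 0 < η) :
    ∃ d > (0:ℝ), ∀ x ∈ K3, ∀ t ∈ K3, dist t x ≤ d → w x - η ≤ w t := by
  obtain ⟨d, hd, h⟩ := Metric.uniformContinuousOn_iff.1
    (hK3.uniformContinuousOn_of_continuous hw) η hη
  refine ⟨d / 2, by positivity, fun x hx t ht hxt => ?_⟩
  have := h x hx t ht (by rw [dist_comm]; linarith)
  rw [Real.dist_eq, abs_lt] at this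
  linarith [this.2]

/-- The improvement step in the comparison argument. -/
lemma comparison_step {N : ℕ} {U : Set (Euc N)} (hU : IsOpen U) {P u θ V : Euc N → ℝ}
    (hP : ContinuousOn P U) (hP0 : ∀ x ∈ U, 0 ≤ P x)
    (hloc : LocallyIntegrableOn u U volume)
    (hsup : ∀ φ, IsTestFun U φ → (∀ x, 0 ≤ φ x) →
      ∫ x in U, P x * u x * φ x ≤ ∫ x in U, u x * (-lap φ x))
    (hθ : ∀ x ∈ U, ContDiffAt ℝ 2 θ x) (hV : ∀ x ∈ U, ContDiffAt ℝ 2 V x)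
    (hVpos : ∀ x ∈ U, 0 < V x)
    (hθsub : ∀ x ∈ U, -lap θ x ≤ P x * θ x) (hVsup : ∀ x ∈ U, P x * V x < -lap V x)
    {M : ℝ} (hM : 0 < M) {K1 : Set (Euc N)} (hK1 : IsCompact K1) (hK1U : K1 ⊆ U)
    (hbd : ∀ᵐ x ∂volume, x ∈ U → x ∉ K1 → θ x - M / 2 * V x ≤ u x)
    (hMu : ∀ᵐ x ∂volume, x ∈ U → θ x - M * V x ≤ u x) :
    ∃ τ > (0:ℝ), ∀ᵐ x ∂volume, x ∈ K1 → θ x - M * V x + τ ≤ u x := by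
  rcases K1.eq_empty_or_nonempty with rfl | hne
  · exact ⟨1, one_pos, by simp⟩
  obtain ⟨r3, hr3, hr3U⟩ := hK1.exists_cthickening_subset_open hU hK1U
  set r := r3 / 3 with hr
  have hr0 : 0 < r := by positivity
  set K3 := cthickening (3 * r) K1 with hK3
  set K := cthickening (2 * r) K1 with hK
  have hK3U : K3 ⊆ U := by rw [hK3, hr, mul_div_cancel₀ _ three_ne_zero]; exact hr3U
  have hK3c : IsCompact K3 := hK1.cthickening
  have hKc : IsCompact K := hK1.cthickening
  have hKK3 : K ⊆ K3 := cthickening_mono (by linarith) _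
  have hK1K : K1 ⊆ K := self_subset_cthickening _
  have hKne : K.Nonempty := hne.mono hK1K
  have hK3ne : K3.Nonempty := hKne.mono hKK3
  have hballK3 : ∀ x ∈ K, ∀ ε, 0 ≤ ε → ε ≤ r → closedBall x ε ⊆ K3 := by
    intro x hx ε hε hεr
    have h1 : closedBall x ε ⊆ cthickening r K :=
      (closedBall_subset_closedBall hεr).trans (closedBall_subset_cthickening hx r)
    refine h1.trans ((cthickening_cthickening_subset hr0.le (by positivity) K1).trans ?_)
    rw [hK3]; exact cthickening_mono (by linarith) _
  -- continuity
  have hVc : ContinuousOn V K3 := fun x hx => (hV x (hK3U hx)).continuousAt.continuousWithinAt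
  have hθc : ContinuousOn θ K3 := fun x hx => (hθ x (hK3U hx)).continuousAt.continuousWithinAt
  have hPc : ContinuousOn P K3 := hP.mono hK3U
  have hlVc : ContinuousOn (lap V) K3 := fun x hx =>
    (continuousAt_lap (hV x (hK3U hx))).continuousWithinAt
  -- constants
  obtain ⟨xv, hxv, hvmin⟩ := hK3c.exists_isMinOn hK3ne hVc
  obtain ⟨xg, hxg, hgmin⟩ := hK3c.exists_isMinOn hK3ne (hlVc.neg.sub (hPc.mul hVc))
  set vm := V xv with hvm
  have hvm0 : 0 < vm := hVpos _ (hK3U hxv)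
  have hvm' : ∀ x ∈ K3, vm ≤ V x := fun x hx => hvmin hx
  set g0 := -lap V xg - P xg * V xg with hg0
  have hg00 : 0 < g0 := by have := hVsup xg (hK3U hxg); rw [hg0]; linarith
  have hg' : ∀ x ∈ K3, g0 ≤ -lap V x - P x * V x := fun x hx => hgmin hx
  set w : Euc N → ℝ := fun x => θ x - M * V x with hw
  set w' : Euc N → ℝ := fun x => θ x - M / 2 * V x with hw'
  have hwc : ContinuousOn w K3 := hθc.sub (continuousOn_const.mul hVc)
  have hw'c : ContinuousOn w' K3 := hθc.sub (continuousOn_const.mul hVc)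
  obtain ⟨d1, hd1, hosc1⟩ := unif_osc hK3c (hPc.mul hwc) (η := M * g0 / 2) (by positivity)
  obtain ⟨d2, hd2, hosc2⟩ := unif_osc hK3c hw'c (η := M * vm / 4) (by positivity)
  set τ := M * vm / 4 with hτ
  have hτ0 : 0 < τ := by positivity
  refine ⟨τ, hτ0, ?_⟩
  obtain ⟨κ, hκcd, hκ0, hκs, hκ1, hκlim⟩ := exists_mollifier N
  have hκcomp : ∀ n, HasCompactSupport (κ n) := fun n =>
    HasCompactSupport.of_support_subset_isCompact (isCompact_closedBall 0 _)
      (subset_closure.trans (hκs n))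
  set u1 := K3.indicator u with hu1
  have huK3 : IntegrableOn u K3 := hloc.integrableOn_compact_subset hK3U hK3c
  have hu1i : Integrable u1 := huK3.integrable_indicator hK3c.measurableSet
  have hPuK3 : IntegrableOn (fun x => P x * u x) K3 := by
    obtain ⟨C, hC⟩ := hK3c.exists_bound_of_continuousOn hPc
    refine Integrable.bdd_mul (c := C) huK3 (hPc.aestronglyMeasurable hK3c.measurableSet) ?_
    rw [ae_restrict_iff' hK3c.measurableSet]
    exact Eventually.of_forall fun x hx => hC x hx
  have hlim := hκlim u1 hu1i.locallyIntegrable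
  have hcdw : ∀ x ∈ U, ContDiffAt ℝ 2 w x := fun x hx =>
    (hθ x hx).sub (contDiffAt_const.mul (hV x hx))
  -- main claim
  have hmain : ∀ᶠ n : ℕ in atTop, ∀ x ∈ K, w x + τ ≤ ∫ t, u1 t * κ n (x - t) := by
    have hsmall : ∀ᶠ n : ℕ in atTop, (1 : ℝ) / (n + 1) < min r (min d1 d2) :=
      tendsto_one_div_add_atTop_nhds_zero_nat.eventually (gt_mem_nhds (by positivity))
    filter_upwards [hsmall] with n hn
    set ε : ℝ := 1 / (n + 1) with hε
    have hε0 : 0 < ε := by positivity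
    have hεr : ε < r := hn.trans_le (min_le_left _ _)
    have hεd1 : ε < d1 := hn.trans_le ((min_le_right _ _).trans (min_le_left _ _))
    have hεd2 : ε < d2 := hn.trans_le ((min_le_right _ _).trans (min_le_right _ _))
    have hκz : ∀ z, κ n z ≠ 0 → ‖z‖ ≤ ε := by
      intro z hz
      have := hκs n (subset_closure hz)
      rw [mem_closedBall, dist_zero_right] at this
      exact this
    set v : Euc N → ℝ := fun x => ∫ t, u1 t * κ n (x - t) with hv
    have hvcd : ContDiff ℝ (⊤ : ℕ∞) v := conv_cd hu1i.locallyIntegrable (hκcd n) (hκcomp n)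
    have hvcd2 : ∀ x, ContDiffAt ℝ 2 v x := fun x =>
      hvcd.contDiffAt.of_le (WithTop.coe_le_coe.2 (le_top : (2:ℕ∞) ≤ ⊤))
    -- Laplacian of the mollification
    have hlap : ∀ x ∈ K, lap v x < lap w x := by
      intro x hx
      have hcb := hballK3 x hx ε hε0.le hεr.le
      have hxK3 : x ∈ K3 := hKK3 hx
      have hxU := hK3U hxK3
      set φ : Euc N → ℝ := fun t => κ n (x - t) with hφ
      have hφt : tsupport φ ⊆ closedBall x ε := by
        refine closure_minimal ?_ isClosed_closedBall
        intro t ht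
        rw [mem_closedBall', dist_eq_norm]; exact hκz _ ht
      have hφtest : IsTestFun U φ := by
        refine ⟨(hκcd n).comp (contDiff_const.sub contDiff_id), ?_, hφt.trans (hcb.trans hK3U)⟩
        exact HasCompactSupport.of_support_subset_isCompact (isCompact_closedBall x ε)
          (subset_closure.trans hφt)
      have h1 := hsup φ hφtest fun t => hκ0 n _
      have h2 : ∫ t in U, u t * (-lap φ t) = -lap v x := by
        rw [hv, conv_lap hu1i.locallyIntegrable (hκcd n) (hκcomp n), ← integral_neg,
          ← integral_indicator hU.measurableSet]
        congr 1; ext t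
        rw [← lap_reflect (hκcd n)]
        change _ = -(u1 t * lap φ t)
        by_cases ht : t ∈ K3
        · rw [Set.indicator_of_mem (hK3U ht), hu1, Set.indicator_of_mem ht]; ring
        · have hz : lap φ t = 0 := lap_zero_off fun h => ht (hcb (hφt h))
          have hu1t : u1 t = 0 := Set.indicator_of_notMem ht u
          rw [hu1t, zero_mul, neg_zero]
          by_cases htU : t ∈ U
          · rw [Set.indicator_of_mem htU, hz]; ring
          · rw [Set.indicator_of_notMem htU]
      have h3 : ∫ t in U, P t * u t * φ t =
          ∫ t, K3.indicator (fun x => P x * u x) t * κ n (x - t) := by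
        rw [← integral_indicator hU.measurableSet]
        congr 1; ext t
        by_cases ht : t ∈ K3
        · rw [Set.indicator_of_mem (hK3U ht), Set.indicator_of_mem ht]
        · have hz : φ t = 0 := by
            by_contra h
            exact ht (hcb (hφt (subset_closure h)))
          rw [Set.indicator_of_notMem ht, zero_mul]
          simp [Set.indicator_apply, hz]
      have h4 := moll_lower (w := fun x => P x * w x) hK3c.measurableSet hPuK3 (hκcd n).continuous
        (hκcomp n) (hκ0 n) (hκ1 n) (x := x) (η := M * g0 / 2) hκz hcb
        (by
          filter_upwards [hMu] with t ht htb
          have htU := hK3U (hcb htb)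
          exact mul_le_mul_of_nonneg_left (ht htU) (hP0 t htU))
        (fun t ht => hosc1 x hxK3 t (hcb ht) ((mem_closedBall.1 ht).trans hεd1.le))
      rw [← h3] at h4
      have h5 : lap w x = lap θ x - M * lap V x := by
        rw [hw, lap_sub (hθ x hxU) (contDiffAt_const.mul (hV x hxU)), lap_const_mul _ (hV x hxU)]
      have h6 := hθsub x hxU
      have h7 := mul_le_mul_of_nonneg_left (hg' x hxK3) hM.le
      have h8 : 0 < M * g0 := by positivity
      have h9 : P x * w x = P x * θ x - M * (P x * V x) := by rw [hw]; ring
      rw [h5]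
      rw [h9] at h4
      rw [h2] at h1
      nlinarith
    -- boundary values
    have hbdry : ∀ x ∈ K, x ∉ cthickening r K1 → w x + τ ≤ v x := by
      intro x hx hxr
      have hcb := hballK3 x hx ε hε0.le hεr.le
      have hxK3 : x ∈ K3 := hKK3 hx
      have h4 := moll_lower (w := w') hK3c.measurableSet huK3 (hκcd n).continuous
        (hκcomp n) (hκ0 n) (hκ1 n) (x := x) (η := M * vm / 4) hκz hcb
        (by
          filter_upwards [hbd] with t ht htb
          refine ht (hK3U (hcb htb)) fun htK => hxr ?_
          exact mem_cthickening_of_dist_le x t r K1 htK ((mem_closedBall'.1 htb).trans hεr.le))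
        (fun t ht => hosc2 x hxK3 t (hcb ht) ((mem_closedBall.1 ht).trans hεd2.le))
      have h5 := hvm' x hxK3
      have h6 : w' x = w x + M / 2 * V x := by rw [hw, hw']; ring
      rw [h6] at h4
      have h7 : M / 2 * vm ≤ M / 2 * V x := by gcongr
      change w x + τ ≤ ∫ t, K3.indicator u t * κ n (x - t)
      rw [hτ]
      linarith
    -- minimum principle
    have hdc : ContinuousOn (fun x => v x - w x) K :=
      hvcd.continuous.continuousOn.sub (hwc.mono hKK3)
    obtain ⟨z, hz, hzmin⟩ := hKc.exists_isMinOn hKne hdc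
    have hzval : τ ≤ v z - w z := by
      by_cases hzr : z ∈ cthickening r K1
      · exfalso
        have hzt : z ∈ thickening (2 * r) K1 := cthickening_subset_thickening' (by positivity) (by linarith) _ hzr
        have hKn : K ∈ 𝓝 z := Filter.mem_of_superset (isOpen_thickening.mem_nhds hzt)
          (thickening_subset_cthickening _ _)
        have hlm : IsLocalMin (fun x => v x - w x) z := hzmin.isLocalMin hKn
        have hzU := hK3U (hKK3 hz)
        have h0 := lap_nonneg_of_isLocalMin ((hvcd2 z).sub (hcdw z hzU)) hlm
        rw [lap_sub (hvcd2 z) (hcdw z hzU)] at h0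
        have := hlap z hz
        linarith
      · have := hbdry z hz hzr
        linarith
    intro x hx
    have h := hzmin hx
    simp only [Set.mem_setOf_eq] at h
    change w x + τ ≤ v x
    linarith
  filter_upwards [hlim] with x hx hxK1
  have hxK := hK1K hxK1
  have hux : u1 x = u x := Set.indicator_of_mem (hKK3 hxK) u
  rw [hux] at hx
  refine ge_of_tendsto hx ?_
  filter_upwards [hmain] with n hn
  exact hn x hxK

/-- The comparison principle. -/
lemma comparison {N : ℕ} {U : Set (Euc N)} (hU : IsOpen U) {P u θ V : Euc N → ℝ}
    (hP : ContinuousOn P U) (hP0 : ∀ x ∈ U, 0 ≤ P x)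
    (hu0 : ∀ᵐ x ∂volume, x ∈ U → 0 ≤ u x)
    (hloc : LocallyIntegrableOn u U volume)
    (hsup : ∀ φ, IsTestFun U φ → (∀ x, 0 ≤ φ x) →
      ∫ x in U, P x * u x * φ x ≤ ∫ x in U, u x * (-lap φ x))
    (hθ : ∀ x ∈ U, ContDiffAt ℝ 2 θ x) (hV : ∀ x ∈ U, ContDiffAt ℝ 2 V x)
    (hVpos : ∀ x ∈ U, 0 < V x)
    (hθsub : ∀ x ∈ U, -lap θ x ≤ P x * θ x) (hVsup : ∀ x ∈ U, P x * V x < -lap V x)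
    (hM0 : ∃ M0 : ℝ, ∀ x ∈ U, θ x ≤ M0 * V x)
    (hbd : ∀ M > (0:ℝ), ∃ K1, IsCompact K1 ∧ K1 ⊆ U ∧
      ∀ᵐ x ∂volume, x ∈ U → x ∉ K1 → θ x - M * V x ≤ u x) :
    ∀ᵐ x ∂volume, x ∈ U → θ x ≤ u x := by
  set S : Set ℝ := {M | 0 ≤ M ∧ ∀ᵐ x ∂volume, x ∈ U → θ x - M * V x ≤ u x} with hS
  have hSne : S.Nonempty := by
    obtain ⟨M0, hM0⟩ := hM0
    refine ⟨max M0 0, le_max_right _ _, ?_⟩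
    filter_upwards [hu0] with x hx hxU
    have h1 := hM0 x hxU
    have h2 : M0 * V x ≤ max M0 0 * V x :=
      mul_le_mul_of_nonneg_right (le_max_left _ _) (hVpos x hxU).le
    linarith [hx hxU]
  have hSb : BddBelow S := ⟨0, fun M hM => hM.1⟩
  set m := sInf S with hm
  have hm0 : 0 ≤ m := le_csInf hSne fun M hM => hM.1
  have hmS : m ∈ S := by
    refine ⟨hm0, ?_⟩
    have h1 : ∀ n : ℕ, ∀ᵐ x ∂volume, x ∈ U → θ x - (m + 1 / ((n:ℝ) + 1)) * V x ≤ u x := by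
      intro n
      have hlt : m < m + 1 / ((n:ℝ) + 1) := by
        have : (0:ℝ) < 1 / (n + 1) := by positivity
        linarith
      obtain ⟨M, hM, hMlt⟩ := exists_lt_of_csInf_lt hSne hlt
      filter_upwards [hM.2] with x hx hxU
      have h2 : M * V x ≤ (m + 1 / ((n:ℝ) + 1)) * V x :=
        mul_le_mul_of_nonneg_right hMlt.le (hVpos x hxU).le
      linarith [hx hxU]
    rw [← ae_all_iff] at h1
    filter_upwards [h1] with x hx hxU
    have ht : Tendsto (fun n : ℕ => θ x - (m + 1 / ((n:ℝ) + 1)) * V x) atTop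
        (𝓝 (θ x - (m + 0) * V x)) :=
      tendsto_const_nhds.sub ((tendsto_const_nhds.add
        tendsto_one_div_add_atTop_nhds_zero_nat).mul_const _)
    rw [add_zero] at ht
    exact le_of_tendsto ht (Eventually.of_forall fun n => hx n hxU)
  rcases hm0.eq_or_lt with h0 | hpos
  · filter_upwards [hmS.2] with x hx hxU
    have := hx hxU
    rw [← h0] at this
    linarith
  exfalso
  obtain ⟨K1, hK1, hK1U, hbd1⟩ := hbd (m / 2) (by positivity)
  obtain ⟨τ, hτ, himp⟩ := comparison_step hU hP hP0 hloc hsup hθ hV hVpos hθsub hVsup hpos hK1 hK1U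
    hbd1 hmS.2
  obtain ⟨C, hC⟩ := hK1.exists_bound_of_continuousOn (f := V)
    (fun x hx => (hV x (hK1U hx)).continuousAt.continuousWithinAt)
  set C' := max C 1 with hC'
  have hC'0 : 0 < C' := by positivity
  set m' := max (m / 2) (m - τ / C') with hm'
  have hm'lt : m' < m := max_lt (by linarith) (by have : 0 < τ / C' := by positivity
                                                  linarith)
  have hm'S : m' ∈ S := by
    refine ⟨le_trans (by positivity) (le_max_left _ _), ?_⟩
    filter_upwards [hbd1, himp] with x hx1 hx2 hxU
    have hVx := (hVpos x hxU).le
    by_cases hxK : x ∈ K1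
    · have h3 := hx2 hxK
      have h4 : (m - τ / C') * V x ≤ m' * V x := mul_le_mul_of_nonneg_right (le_max_right _ _) hVx
      have h5 : τ / C' * V x ≤ τ := by
        have h6 : V x ≤ C' := (le_abs_self _).trans ((hC x hxK).trans (le_max_left _ _))
        calc τ / C' * V x ≤ τ / C' * C' := by gcongr
          _ = τ := by field_simp
      linarith
    · have h3 := hx1 hxU hxK
      have h4 : m / 2 * V x ≤ m' * V x := mul_le_mul_of_nonneg_right (le_max_left _ _) hVx
      linarith
  exact absurd (csInf_le hSb hm'S) (not_le.2 hm'lt)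



lemma barrier_identity {N : ℕ} {s r : Euc N → ℝ} {x : Euc N} (c : ℝ) (hs : ContDiffAt ℝ 2 s x)
    (hr : ContDiffAt ℝ 2 r x) {l l' : ℝ → ℝ} {l'' : ℝ} (hlc : ContDiffAt ℝ 2 l (s x))
    (hl : ∀ᶠ t in 𝓝 (s x), HasDerivAt l (l' t) t) (hl' : HasDerivAt l' l'' (s x)) :
    lap (fun y => Real.exp (c * s y - r y * s y + l (s y))) x =
      Real.exp (c * s x - r x * s x + l (s x)) *
      (c * lap s x - (r x * lap s x + s x * lap r x + 2 * gdot r s x) + l' (s x) * lap s x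
        + l'' * gdot s s x + (c - r x + l' (s x)) ^ 2 * gdot s s x
        - 2 * s x * (c - r x + l' (s x)) * gdot r s x + s x ^ 2 * gdot r r x) := by
  have h1 : ContDiffAt ℝ 2 (fun y => c * s y) x := contDiffAt_const.mul hs
  have h2 : ContDiffAt ℝ 2 (fun y => r y * s y) x := hr.mul hs
  have h3 : ContDiffAt ℝ 2 (fun y => l (s y)) x := hlc.comp x hs
  have h4 : ContDiffAt ℝ 2 (fun y => c * s y - r y * s y) x := h1.sub h2
  have h5 : ContDiffAt ℝ 2 (fun y => c * s y - r y * s y + l (s y)) x := h4.add h3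
  have e1 : lap (fun y => c * s y - r y * s y + l (s y)) x =
      c * lap s x - (r x * lap s x + s x * lap r x + 2 * gdot r s x) + (l' (s x) * lap s x
        + l'' * gdot s s x) := by
    rw [lap_add h4 h3, lap_sub h1 h2, lap_const_mul c hs, lap_mul hr hs, lap_comp hs hl hl']
  have e2 : fderiv ℝ (fun y => c * s y - r y * s y + l (s y)) x =
      (c • fderiv ℝ s x - (r x • fderiv ℝ s x + s x • fderiv ℝ r x)) + l' (s x) • fderiv ℝ s x := by
    rw [fderiv_fun_add (cd2_diff h4) (cd2_diff h3), fderiv_fun_sub (cd2_diff h1) (cd2_diff h2),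
      fderiv_fun_mul (cd2_diff hr) (cd2_diff hs), fderiv_comp_ev (cd2_diff hs) hl.self_of_nhds,
      fderiv_const_mul (cd2_diff hs)]
  have e3 : gdot (fun y => c * s y - r y * s y + l (s y))
      (fun y => c * s y - r y * s y + l (s y)) x =
      (c - r x + l' (s x)) ^ 2 * gdot s s x
        - 2 * s x * (c - r x + l' (s x)) * gdot r s x + s x ^ 2 * gdot r r x := by
    unfold gdot
    rw [e2, Finset.mul_sum, Finset.mul_sum, Finset.mul_sum, ← Finset.sum_sub_distrib,
      ← Finset.sum_add_distrib]
    refine Finset.sum_congr rfl fun i _ => ?_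
    simp only [_root_.add_apply, _root_.sub_apply,
      _root_.smul_apply, smul_eq_mul]
    ring
  rw [lap_comp h5 (Eventually.of_forall fun t => Real.hasDerivAt_exp t) (Real.hasDerivAt_exp _),
    e1, e3]
  ring

/-- geometric facts on the distance -/
lemma dist_facts {N : ℕ} {Γ : Set (Euc N)} (hc : IsCompact Γ) (hne : Γ.Nonempty) {x : Euc N}
    (hx : ContDiffAt ℝ 2 (nu Γ) x) (hpos : 0 < distG Γ x) :
    ContDiffAt ℝ 2 (distG Γ) x ∧ gdot (distG Γ) (distG Γ) x = 1 ∧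
      lap (distG Γ) x = lap (fun x => distG Γ x ^ 2) x / (2 * distG Γ x) - 1 / distG Γ x := by
  set d := distG Γ x with hd
  have hfun : distG Γ = fun y => √(distG Γ y ^ 2) := by
    ext y; exact (Real.sqrt_sq (infDist_nonneg (s := Γ))).symm
  have hrho := rho_cd hc hne hx
  have hne0 : distG Γ x ^ 2 ≠ 0 := by positivity
  have hcd : ContDiffAt ℝ 2 (distG Γ) x := by
    rw [hfun]
    exact hrho.sqrt hne0
  have hsq : √(distG Γ x ^ 2) = d := Real.sqrt_sq hpos.le
  have hg : ∀ᶠ t in 𝓝 (distG Γ x ^ 2), HasDerivAt Real.sqrt (1 / (2 * √t)) t := by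
    filter_upwards [isOpen_ne.mem_nhds hne0] with t ht
    exact Real.hasDerivAt_sqrt ht
  have hg' : HasDerivAt (fun t => 1 / (2 * √t)) (-(1 / (4 * d ^ 3))) (distG Γ x ^ 2) := by
    have h := ((Real.hasDerivAt_sqrt hne0).const_mul 2).inv (by rw [hsq]; positivity)
    simp only [one_div]
    refine h.congr_deriv ?_
    rw [hsq]; field_simp; norm_num
  have hgd := rho_gdot hc hne (hx.differentiableAt (by norm_num))
  refine ⟨hcd, ?_, ?_⟩
  · have hf : fderiv ℝ (fun x => distG Γ x ^ 2) x = (2 * d) • fderiv ℝ (distG Γ) x := by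
      have := fderiv_comp_ev (g := fun t => t ^ 2) (cd2_diff hcd) (by simpa using hasDerivAt_pow 2 (distG Γ x))
      exact this
    have h1 : gdot (fun x => distG Γ x ^ 2) (fun x => distG Γ x ^ 2) x =
        4 * d ^ 2 * gdot (distG Γ) (distG Γ) x := by
      unfold gdot
      rw [hf, Finset.mul_sum]
      refine Finset.sum_congr rfl fun i _ => ?_
      simp only [_root_.smul_apply, smul_eq_mul]
      ring
    rw [h1, ← hd] at hgd
    have : 4 * d ^ 2 ≠ 0 := by positivity
    exact mul_left_cancel₀ this (by linarith)
  · have := lap_comp hrho hg hg'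
    rw [← hfun, hgd, hsq] at this
    rw [this, ← hd]
    field_simp
    ring

/-- the logarithmic distance -/
def sF {N : ℕ} (Γ : Set (Euc N)) (x : Euc N) : ℝ := -Real.log (distG Γ x)

lemma s_facts {N : ℕ} {Γ : Set (Euc N)} (hc : IsCompact Γ) (hne : Γ.Nonempty) {x : Euc N}
    (hx : ContDiffAt ℝ 2 (nu Γ) x) (hpos : 0 < distG Γ x) :
    ContDiffAt ℝ 2 (sF Γ) x ∧ gdot (sF Γ) (sF Γ) x = 1 / distG Γ x ^ 2 ∧
      lap (sF Γ) x = (4 - lap (fun x => distG Γ x ^ 2) x) / (2 * distG Γ x ^ 2) := by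
  obtain ⟨h1, h2, h3⟩ := dist_facts hc hne hx hpos
  set d := distG Γ x with hd
  have hcd : ContDiffAt ℝ 2 (sF Γ) x := (h1.log hpos.ne').neg
  have hg : ∀ᶠ t in 𝓝 (distG Γ x), HasDerivAt (fun t => -Real.log t) (-t⁻¹) t := by
    filter_upwards [isOpen_ne.mem_nhds hpos.ne'] with t ht
    exact (Real.hasDerivAt_log ht).neg
  have hg' : HasDerivAt (fun t : ℝ => -t⁻¹) (1 / d ^ 2) (distG Γ x) := by
    refine (hasDerivAt_inv hpos.ne').neg.congr_deriv ?_
    field_simp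
  refine ⟨hcd, ?_, ?_⟩
  · have hf : fderiv ℝ (sF Γ) x = (-d⁻¹) • fderiv ℝ (distG Γ) x :=
      fderiv_comp_ev (cd2_diff h1) hg.self_of_nhds
    have : gdot (sF Γ) (sF Γ) x = d⁻¹ ^ 2 * gdot (distG Γ) (distG Γ) x := by
      unfold gdot
      rw [hf, Finset.mul_sum]
      refine Finset.sum_congr rfl fun i _ => ?_
      simp only [_root_.smul_apply, smul_eq_mul]
      ring
    rw [this, h2]; field_simp
  · have := lap_comp h1 hg hg'
    change lap (sF Γ) x = _ at this
    rw [this, h2, h3, ← hd]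
    field_simp
    ring

/-- facts about `r = c √f` -/
lemma r_facts {N : ℕ} {f : Euc N → ℝ} {x : Euc N} (c : ℝ) (hf : ContDiffAt ℝ 2 f x)
    (hpos : 0 < f x) :
    ContDiffAt ℝ 2 (fun y => c * √(f y)) x ∧
    gdot (fun y => c * √(f y)) (fun y => c * √(f y)) x = c ^ 2 / (4 * f x) * gdot f f x ∧
    lap (fun y => c * √(f y)) x = c * (lap f x / (2 * √(f x)) - gdot f f x / (4 * √(f x) ^ 3)) := by
  have hs0 : 0 < √(f x) := Real.sqrt_pos.2 hpos
  have hss : √(f x) ^ 2 = f x := Real.sq_sqrt hpos.le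
  have hg : ∀ᶠ t in 𝓝 (f x), HasDerivAt Real.sqrt (1 / (2 * √t)) t := by
    filter_upwards [isOpen_ne.mem_nhds hpos.ne'] with t ht
    exact Real.hasDerivAt_sqrt ht
  have hg' : HasDerivAt (fun t => 1 / (2 * √t)) (-(1 / (4 * √(f x) ^ 3))) (f x) := by
    have h := ((Real.hasDerivAt_sqrt hpos.ne').const_mul 2).inv (by positivity)
    simp only [one_div]
    refine h.congr_deriv ?_
    field_simp; norm_num
  have h0 : ContDiffAt ℝ 2 (fun y => √(f y)) x := hf.sqrt hpos.ne'
  refine ⟨contDiffAt_const.mul h0, ?_, ?_⟩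
  · have hfd : fderiv ℝ (fun y => c * √(f y)) x = (c * (1 / (2 * √(f x)))) • fderiv ℝ f x :=
      fderiv_comp_ev (g := fun t => c * √t) (cd2_diff hf) (hg.self_of_nhds.const_mul c)
    have : gdot (fun y => c * √(f y)) (fun y => c * √(f y)) x =
        (c * (1 / (2 * √(f x)))) ^ 2 * gdot f f x := by
      unfold gdot
      rw [hfd, Finset.mul_sum]
      refine Finset.sum_congr rfl fun i _ => ?_
      simp only [_root_.smul_apply, smul_eq_mul]
      ring
    rw [this]
    congr 1
    rw [mul_pow, div_pow, mul_pow, hss]; ring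
  · rw [lap_const_mul c h0, lap_comp hf hg hg']
    ring

/-- facts about `f = 1 - q + K δ` -/
lemma f_facts {N : ℕ} {q d : Euc N → ℝ} {x : Euc N} (K : ℝ) (hq : ContDiffAt ℝ 2 q x)
    (hd : ContDiffAt ℝ 2 d x) :
    ContDiffAt ℝ 2 (fun y => 1 - q y + K * d y) x ∧
    gdot (fun y => 1 - q y + K * d y) (fun y => 1 - q y + K * d y) x
      ≤ 2 * gdot q q x + 2 * K ^ 2 * gdot d d x ∧
    lap (fun y => 1 - q y + K * d y) x = - lap q x + K * lap d x := by
  have h1 : ContDiffAt ℝ 2 (fun y => 1 - q y) x := contDiffAt_const.sub hq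
  have h2 : ContDiffAt ℝ 2 (fun y => K * d y) x := contDiffAt_const.mul hd
  refine ⟨h1.add h2, ?_, ?_⟩
  · have hfd : fderiv ℝ (fun y => 1 - q y + K * d y) x = -fderiv ℝ q x + K • fderiv ℝ d x := by
      rw [fderiv_fun_add (cd2_diff h1) (cd2_diff h2), fderiv_const_sub,
        fderiv_const_mul (cd2_diff hd)]
    unfold gdot
    rw [hfd, Finset.mul_sum, Finset.mul_sum, ← Finset.sum_add_distrib]
    refine Finset.sum_le_sum fun i _ => ?_
    simp only [_root_.smul_apply, smul_eq_mul, _root_.add_apply,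
      _root_.neg_apply]
    nlinarith [sq_nonneg (fderiv ℝ q x (ev i) + K * fderiv ℝ d x (ev i))]
  · rw [lap_add h1 h2, lap_const_mul K hd]
    congr 1
    have := lap_comp (g := fun t => 1 - t) (g' := fun _ => -1) (g'' := 0) hq
      (Eventually.of_forall fun t => by simpa using (hasDerivAt_id t).const_sub 1)
      (hasDerivAt_const _ _)
    rw [this]; ring



set_option maxHeartbeats 1000000 in
lemma bracket_num {c K B C1 C4 C5 t s r qx Λ lr grs grr l1 l2 : ℝ} (hc : 0 ≤ c) (hK : 0 ≤ K)
    (hB : 0 ≤ B) (hC1 : 0 ≤ C1) (hC4 : 0 ≤ C4) (hC5 : 0 ≤ C5)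
    (ht : 0 < t) (ht1 : t ≤ 1) (hs : 1 ≤ s) (hr0 : 0 ≤ r) (hrB : r ≤ B)
    (hr2 : r ^ 2 = c ^ 2 * (1 - qx + K * t ^ 2)) (hl1 : |l1| ≤ 1)
    (hΛ : |Λ - (4 * c + 4)| ≤ C1 * t ^ 2) (hlr : |lr| ≤ C5 / t ^ 3)
    (hgrr0 : 0 ≤ grr) (hgrr : grr ≤ C4 ^ 2 / t ^ 2) (hgrs : grs ^ 2 ≤ grr * (1 / (t ^ 2) ^ 2)) :
    |(t ^ 2) ^ 2 * (c * ((4 - Λ) / (2 * (t ^ 2) ^ 2))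
        - (r * ((4 - Λ) / (2 * (t ^ 2) ^ 2)) + s * lr + 2 * grs)
        + l1 * ((4 - Λ) / (2 * (t ^ 2) ^ 2)) + l2 * (1 / (t ^ 2) ^ 2)
        + (c - r + l1) ^ 2 * (1 / (t ^ 2) ^ 2)
        - 2 * s * (c - r + l1) * grs + s ^ 2 * grr) + c ^ 2 * qx
      - (-2 * r * l1 + l1 ^ 2 + l2)|
      ≤ (c ^ 2 * K + (c + B + 1) * C1 + C5 + 2 * C4 + 2 * (c + B + 1) * C4 + C4 ^ 2)
        * (s ^ 2 * t) := by
  set m := c - r + l1 with hm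
  have hmM : |m| ≤ c + B + 1 := by
    rw [abs_le] at hl1 ⊢; constructor <;> linarith [hl1.1, hl1.2]
  have hM0 : 0 ≤ c + B + 1 := by positivity
  have hg : |(t ^ 2) ^ 2 * grs| ≤ C4 * t := by
    have h1 : grs ^ 2 ≤ (C4 / t ^ 3) ^ 2 := by
      refine hgrs.trans ((mul_le_mul_of_nonneg_right hgrr (by positivity)).trans (le_of_eq ?_))
      field_simp
    have h2 : |grs| ≤ C4 / t ^ 3 := abs_le_of_sq_le_sq h1 (by positivity)
    rw [abs_mul, abs_of_nonneg (by positivity : (0:ℝ) ≤ (t ^ 2) ^ 2)]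
    calc (t ^ 2) ^ 2 * |grs| ≤ (t ^ 2) ^ 2 * (C4 / t ^ 3) := by gcongr
      _ = C4 * t := by field_simp
  have hl : |(t ^ 2) ^ 2 * lr| ≤ C5 * t := by
    rw [abs_mul, abs_of_nonneg (by positivity : (0:ℝ) ≤ (t ^ 2) ^ 2)]
    calc (t ^ 2) ^ 2 * |lr| ≤ (t ^ 2) ^ 2 * (C5 / t ^ 3) := by gcongr
      _ = C5 * t := by field_simp
  have hrr : |(t ^ 2) ^ 2 * grr| ≤ C4 ^ 2 * t := by
    rw [abs_of_nonneg (by positivity)]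
    calc (t ^ 2) ^ 2 * grr ≤ (t ^ 2) ^ 2 * (C4 ^ 2 / t ^ 2) := by gcongr
      _ = C4 ^ 2 * t * t := by field_simp
      _ ≤ C4 ^ 2 * t * 1 := by gcongr
      _ = C4 ^ 2 * t := mul_one _
  have hs0 : 0 ≤ s := by linarith
  have hss : s ≤ s ^ 2 := by nlinarith
  have h1s : 1 ≤ s ^ 2 := by nlinarith
  have htt : t ^ 2 ≤ t := by nlinarith
  have htst : t ^ 2 ≤ s ^ 2 * t := htt.trans (le_mul_of_one_le_left ht.le h1s)
  have key : (t ^ 2) ^ 2 * (c * ((4 - Λ) / (2 * (t ^ 2) ^ 2))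
        - (r * ((4 - Λ) / (2 * (t ^ 2) ^ 2)) + s * lr + 2 * grs)
        + l1 * ((4 - Λ) / (2 * (t ^ 2) ^ 2)) + l2 * (1 / (t ^ 2) ^ 2)
        + m ^ 2 * (1 / (t ^ 2) ^ 2)
        - 2 * s * m * grs + s ^ 2 * grr) + c ^ 2 * qx
      - (-2 * r * l1 + l1 ^ 2 + l2) =
      c ^ 2 * K * t ^ 2 + -(m * (Λ - (4 * c + 4)) / 2) + -(s * ((t ^ 2) ^ 2 * lr)) +
      -(2 * ((t ^ 2) ^ 2 * grs)) + -(2 * s * m * ((t ^ 2) ^ 2 * grs)) +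
      s ^ 2 * ((t ^ 2) ^ 2 * grr) := by
    have h0 : (t ^ 2) ^ 2 ≠ 0 := by positivity
    generalize (t ^ 2) ^ 2 = T at h0 ⊢
    have e : r ^ 2 - c ^ 2 * (1 - qx + K * t ^ 2) = 0 := by linarith
    have : ∀ y z : ℝ, y - z = r ^ 2 - c ^ 2 * (1 - qx + K * t ^ 2) → y = z := by
      intro y z h; linarith
    apply this
    rw [hm]
    field_simp
    ring
  rw [key]
  have a1 : |c ^ 2 * K * t ^ 2| ≤ c ^ 2 * K * (s ^ 2 * t) := by
    rw [abs_of_nonneg (by positivity)]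
    gcongr
  have a2 : |-(m * (Λ - (4 * c + 4)) / 2)| ≤ (c + B + 1) * C1 * (s ^ 2 * t) := by
    rw [abs_neg, abs_div, abs_mul, abs_two]
    have h2 : |m| * |Λ - (4 * c + 4)| ≤ (c + B + 1) * (C1 * t ^ 2) :=
      mul_le_mul hmM hΛ (abs_nonneg _) hM0
    have h3 : (c + B + 1) * (C1 * t ^ 2) ≤ (c + B + 1) * C1 * (s ^ 2 * t) := by
      rw [← mul_assoc]; gcongr
    have : 0 ≤ |m| * |Λ - (4 * c + 4)| := by positivity
    linarith
  have a3 : |-(s * ((t ^ 2) ^ 2 * lr))| ≤ C5 * (s ^ 2 * t) := by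
    rw [abs_neg, abs_mul, abs_of_nonneg hs0]
    calc s * |(t ^ 2) ^ 2 * lr| ≤ s ^ 2 * (C5 * t) := by gcongr
      _ = _ := by ring
  have a4 : |-(2 * ((t ^ 2) ^ 2 * grs))| ≤ 2 * C4 * (s ^ 2 * t) := by
    rw [abs_neg, abs_mul, abs_two]
    calc 2 * |(t ^ 2) ^ 2 * grs| ≤ 2 * (C4 * t) * 1 := by rw [mul_one]; gcongr
      _ ≤ 2 * (C4 * t) * s ^ 2 := by gcongr
      _ = _ := by ring
  have a5 : |-(2 * s * m * ((t ^ 2) ^ 2 * grs))| ≤ 2 * (c + B + 1) * C4 * (s ^ 2 * t) := by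
    rw [abs_neg, abs_mul, abs_mul, abs_mul, abs_two, abs_of_nonneg hs0]
    calc 2 * s * |m| * |(t ^ 2) ^ 2 * grs| ≤ 2 * s ^ 2 * (c + B + 1) * (C4 * t) := by gcongr
      _ = _ := by ring
  have a6 : |s ^ 2 * ((t ^ 2) ^ 2 * grr)| ≤ C4 ^ 2 * (s ^ 2 * t) := by
    rw [abs_mul, abs_of_nonneg (by positivity : 0 ≤ s ^ 2)]
    calc s ^ 2 * |(t ^ 2) ^ 2 * grr| ≤ s ^ 2 * (C4 ^ 2 * t) := by gcongr
      _ = _ := by ring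
  refine (abs_add_le _ _).trans ?_
  have tri : ∀ y1 y2 y3 y4 y5 : ℝ, |y1 + y2 + y3 + y4 + y5| ≤ |y1| + |y2| + |y3| + |y4| + |y5| := by
    intro y1 y2 y3 y4 y5
    have h1 := abs_add_le (y1 + y2 + y3 + y4) y5
    have h2 := abs_add_le (y1 + y2 + y3) y4
    have h3 := abs_add_le (y1 + y2) y3
    have h4 := abs_add_le y1 y2
    linarith
  refine (add_le_add (tri _ _ _ _ _) a6).trans ?_
  refine (add_le_add_left (add_le_add (add_le_add (add_le_add (add_le_add a1 a2) a3) a4) a5) _).trans (le_of_eq ?_)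
  ring



/-- the auxiliary function `f = 1 - q + K δ` -/
def fF {N : ℕ} (Γ : Set (Euc N)) (q : Euc N → ℝ) (K : ℝ) (x : Euc N) : ℝ :=
  1 - q x + K * distG Γ x

lemma q_bounds {N : ℕ} {Γ Ω : Set (Euc N)} (hc : IsCompact Γ) (hΩo : IsOpen Ω)
    (hΓΩ : Γ ⊆ Ω) (hne : Γ.Nonempty) {q : Euc N → ℝ} (hq : ∀ x ∈ Ω, ContDiffAt ℝ 2 q x) :
    ∃ R > (0:ℝ), ∃ Q > (0:ℝ), ∀ x, distG Γ x ≤ R → x ∈ Ω ∧ gdot q q x ≤ Q ∧ |lap q x| ≤ Q := by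
  obtain ⟨R, hR, hRW⟩ := hc.exists_cthickening_subset_open hΩo hΓΩ
  have hcc : IsCompact (Metric.cthickening R Γ) := hc.cthickening
  obtain ⟨A, hA⟩ := hcc.exists_bound_of_continuousOn (f := gdot q q) fun x hx =>
    (continuousAt_gdot (hq x (hRW hx))).continuousWithinAt
  obtain ⟨B, hB⟩ := hcc.exists_bound_of_continuousOn (f := lap q) fun x hx =>
    (continuousAt_lap (hq x (hRW hx))).continuousWithinAt
  refine ⟨R, hR, |A| + |B| + 1, by positivity, fun x hx => ?_⟩
  have hxm : x ∈ Metric.cthickening R Γ := by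
    rw [Metric.mem_cthickening_iff]
    rw [distG, infDist] at hx
    exact ENNReal.le_ofReal_iff_toReal_le (infEDist_ne_top hne) hR.le |>.2 hx
  have h1 := hA x hxm
  have h2 := hB x hxm
  rw [Real.norm_eq_abs] at h1 h2
  refine ⟨hRW hxm, ?_, ?_⟩
  · linarith [le_abs_self (gdot q q x), le_abs_self A, abs_nonneg B]
  · linarith [le_abs_self B, abs_nonneg A]

set_option maxHeartbeats 4000000 in
lemma barrier_est {N k : ℕ} (hk2 : k + 2 < N) {Γ Ω : Set (Euc N)}
    (hΓ : IsSmoothSubmanifold N k Γ) (hΩo : IsOpen Ω) (hΓΩ : Γ ⊆ Ω) {q : Euc N → ℝ}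
    (hq : ∀ x ∈ Ω, ContDiffAt ℝ 2 q x) (hq0 : ∀ x ∈ Ω, 0 ≤ q x) (hq1 : ∀ σ ∈ Γ, q σ ≤ 1)
    {c : ℝ} (hcN : 4 * c + 4 = 2 * ((N:ℝ) - k)) (hc0 : 0 < c) :
    ∃ L > (0:ℝ), ∃ K > (0:ℝ), ∃ R > (0:ℝ), R ≤ Real.exp (-1) ∧ ∃ C8 > (0:ℝ),
      (∀ x, distG Γ x ≤ R → x ∈ Ω ∧ ContDiffAt ℝ 2 (nu Γ) x ∧
        |q x - q (nu Γ x)| ≤ L * distG Γ x ∧ distG Γ x ≤ fF Γ q K x) ∧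
      ∀ x, 0 < distG Γ x → distG Γ x ≤ R → ContDiffAt ℝ 2 (sF Γ) x ∧
        ContDiffAt ℝ 2 (fun y => c * √(fF Γ q K y)) x ∧
        ∀ (l l' : ℝ → ℝ) (l'' : ℝ), ContDiffAt ℝ 2 l (sF Γ x) →
          (∀ᶠ t in 𝓝 (sF Γ x), HasDerivAt l (l' t) t) → HasDerivAt l' l'' (sF Γ x) →
          |l' (sF Γ x)| ≤ 1 →
          ∃ E, |E| ≤ C8 * (sF Γ x ^ 2 * √(distG Γ x)) ∧
            lap (fun y => Real.exp (c * sF Γ y - (c * √(fF Γ q K y)) * sF Γ y + l (sF Γ y))) x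
              + c ^ 2 * q x / distG Γ x ^ 2 * Real.exp (c * sF Γ x - (c * √(fF Γ q K x)) * sF Γ x
                + l (sF Γ x)) =
            Real.exp (c * sF Γ x - (c * √(fF Γ q K x)) * sF Γ x + l (sF Γ x)) / distG Γ x ^ 2 *
              (-2 * (c * √(fF Γ q K x)) * l' (sF Γ x) + l' (sF Γ x) ^ 2 + l'' + E) := by
  have hkN : k < N := by omega
  obtain ⟨hc, hne, -⟩ := id hΓ
  obtain ⟨W, hWo, hΓW, hWcd, R1, hR1, C1, hC1, hgeo⟩ := tube_geometry hkN hΓ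
  obtain ⟨R2, hR2, L, hL, hlip⟩ := lip_nu hc hne hΩo hΓΩ
    (fun x hx => (hq x hx).of_le (by norm_num : (1 : WithTop ℕ∞) ≤ 2))
  obtain ⟨R3, hR3, Q, hQ, hqb⟩ := q_bounds hc hΩo hΓΩ hne hq
  set K := L + 1 with hKdef
  have hK : 0 < K := by positivity
  set R := min (min R1 R2) (min R3 (Real.exp (-1))) with hR
  have hR0 : 0 < R := by positivity
  have hle1 : R ≤ R1 := (min_le_left _ _).trans (min_le_left _ _)
  have hle2 : R ≤ R2 := (min_le_left _ _).trans (min_le_right _ _)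
  have hle3 : R ≤ R3 := (min_le_right _ _).trans (min_le_left _ _)
  have hle4 : R ≤ Real.exp (-1) := (min_le_right _ _).trans (min_le_right _ _)
  set C2 := 2 * Q + 2 * K ^ 2 with hC2
  set C3 := Q + K * (4 * c + 2 + C1) with hC3
  set C4 := c * (C2 + 1) with hC4
  set C5 := c * (C3 + C2) with hC5
  set B := c * √(1 + K) with hB
  have hC20 : 0 < C2 := by positivity
  have hC30 : 0 < C3 := by positivity
  have hC40 : 0 < C4 := by positivity
  have hC50 : 0 < C5 := by positivity
  have hB0 : 0 ≤ B := by positivity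
  have hf : ∀ x, distG Γ x ≤ R → distG Γ x ≤ fF Γ q K x := by
    intro x hx
    have h1 := hlip x (hx.trans hle2)
    have h2 := hq1 _ (nu_spec hc hne x).1
    rw [abs_le] at h1
    rw [fF, hKdef]
    linarith [h1.2]
  refine ⟨L, hL, K, hK, R, hR0, hle4,
    c ^ 2 * K + (c + B + 1) * C1 + C5 + 2 * C4 + 2 * (c + B + 1) * C4 + C4 ^ 2, by positivity,
    fun x hx => ⟨(hqb x (hx.trans hle3)).1, hWcd x (hgeo x (hx.trans hle1)).1,
      hlip x (hx.trans hle2), hf x hx⟩, ?_⟩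
  intro x hpos hx
  obtain ⟨hxW, hΛ⟩ := hgeo x (hx.trans hle1)
  obtain ⟨hxΩ, hgq, hlq⟩ := hqb x (hx.trans hle3)
  have hfx := hf x hx
  obtain ⟨d1, d2, d3⟩ := dist_facts hc hne (hWcd x hxW) hpos
  obtain ⟨s1, s2, s3⟩ := s_facts hc hne (hWcd x hxW) hpos
  obtain ⟨f1, f2, f3⟩ := f_facts K (hq x hxΩ) d1
  change ContDiffAt ℝ 2 (fF Γ q K) x at f1
  change gdot (fF Γ q K) (fF Γ q K) x ≤ _ at f2
  change lap (fF Γ q K) x = _ at f3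
  have hf0 : 0 < fF Γ q K x := hpos.trans_le hfx
  obtain ⟨r1, r2, r3⟩ := r_facts c f1 hf0
  refine ⟨s1, r1, fun l l' l'' hlc hl hl' hl1 => ?_⟩
  rw [barrier_identity c s1 r1 hlc hl hl']
  have hcs := gdot_sq_le (fun y => c * √(fF Γ q K y)) (sF Γ) x
  have hrr0 := gdot_self_nonneg (fun y => c * √(fF Γ q K y)) x
  set d := distG Γ x with hd
  set t := √d with ht
  have ht0 : 0 < t := Real.sqrt_pos.2 hpos
  have htd : t ^ 2 = d := Real.sq_sqrt hpos.le
  have hd1 : d ≤ 1 := (hx.trans hle4).trans (by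
    rw [← Real.exp_zero]; exact Real.exp_le_exp.2 (by norm_num))
  have ht1 : t ≤ 1 := by rw [ht]; exact Real.sqrt_le_one.2 hd1
  have hs1 : 1 ≤ sF Γ x := by
    rw [sF, le_neg, ← hd]
    rw [← Real.log_exp (-1)]
    exact Real.log_le_log hpos (hx.trans hle4)
  have hqx := hq0 x hxΩ
  have hfF : fF Γ q K x = 1 - q x + K * d := rfl
  have hfB : fF Γ q K x ≤ 1 + K := by rw [hfF]; nlinarith
  have hts : t ≤ √(fF Γ q K x) := Real.sqrt_le_sqrt hfx
  have hgff : gdot (fF Γ q K) (fF Γ q K) x ≤ C2 := by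
    rw [d2] at f2; rw [hC2]; linarith
  have hgff0 := gdot_self_nonneg (fF Γ q K) x
  have hlapd : |lap (distG Γ) x| ≤ (4 * c + 2 + C1) / d := by
    rw [← hcN] at hΛ
    have : lap (distG Γ) x = ((lap (fun x => distG Γ x ^ 2) x - (4 * c + 4)) + (4 * c + 2)) / (2 * d) := by
      rw [d3]; field_simp; ring
    rw [this, abs_div, abs_of_pos (by positivity : 0 < 2 * d)]
    have h2 : |(lap (fun x => distG Γ x ^ 2) x - (4 * c + 4)) + (4 * c + 2)| ≤ 4 * c + 2 + C1 := by
      refine (abs_add_le _ _).trans ?_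
      rw [abs_of_pos (by positivity : 0 < 4 * c + 2)]
      nlinarith
    calc _ ≤ (4 * c + 2 + C1) / (2 * d) := by gcongr
      _ ≤ (4 * c + 2 + C1) / d := by gcongr; linarith
  have hlapf : |lap (fF Γ q K) x| ≤ C3 / d := by
    rw [f3]
    refine (abs_add_le _ _).trans ?_
    rw [abs_neg, abs_mul, abs_of_pos hK, hC3, add_div, mul_div_assoc]
    refine add_le_add (hlq.trans ?_) (by gcongr)
    rw [le_div_iff₀ hpos]; nlinarith
  have hlr : |lap (fun y => c * √(fF Γ q K y)) x| ≤ C5 / t ^ 3 := by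
    rw [r3, abs_mul, abs_of_pos hc0, hC5, mul_div_assoc]
    refine mul_le_mul_of_nonneg_left ?_ hc0.le
    refine (abs_sub _ _).trans ?_
    rw [add_div]
    refine add_le_add ?_ ?_
    · rw [abs_div, abs_of_pos (by positivity : 0 < 2 * √(fF Γ q K x))]
      calc |lap (fF Γ q K) x| / (2 * √(fF Γ q K x)) ≤ (C3 / d) / (1 * t) := by
            gcongr; norm_num
        _ = C3 / t ^ 3 := by rw [← htd]; field_simp
    · rw [abs_div, abs_of_nonneg hgff0, abs_of_pos (by positivity : 0 < 4 * √(fF Γ q K x) ^ 3)]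
      calc gdot (fF Γ q K) (fF Γ q K) x / (4 * √(fF Γ q K x) ^ 3) ≤ C2 / (1 * t ^ 3) := by
            gcongr; norm_num
        _ = C2 / t ^ 3 := by rw [one_mul]
  have hgrr : gdot (fun y => c * √(fF Γ q K y)) (fun y => c * √(fF Γ q K y)) x ≤ C4 ^ 2 / t ^ 2 := by
    rw [r2, htd]
    calc c ^ 2 / (4 * fF Γ q K x) * gdot (fF Γ q K) (fF Γ q K) x ≤ c ^ 2 / (1 * d) * C2 := by
          gcongr; norm_num
      _ = (c ^ 2 * C2) / d := by field_simp
      _ ≤ C4 ^ 2 / d := by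
          refine div_le_div_of_nonneg_right ?_ hpos.le
          rw [hC4, mul_pow]
          refine mul_le_mul_of_nonneg_left ?_ (sq_nonneg c)
          have h3 : (C2 + 1) ^ 2 = C2 ^ 2 + 2 * C2 + 1 := by ring
          rw [h3]
          linarith [sq_nonneg C2]
  rw [s2] at hcs ⊢
  rw [s3]
  clear_value C2 C3 C4 C5 B K R
  rw [← hcN] at hΛ
  rw [← htd] at hcs hΛ ⊢
  have hr2 : (c * √(fF Γ q K x)) ^ 2 = c ^ 2 * (1 - q x + K * t ^ 2) := by
    rw [mul_pow, Real.sq_sqrt hf0.le, hfF, htd]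
  have hrB : c * √(fF Γ q K x) ≤ B := by
    rw [hB]; gcongr
  have hfin := bracket_num (l2 := l'') hc0.le hK.le hB0 hC1.le hC40.le hC50.le ht0 ht1 hs1
    (by positivity) hrB hr2 hl1 hΛ hlr hrr0 hgrr hcs
  refine ⟨_, hfin, ?_⟩
  have hT : (t ^ 2) ^ 2 ≠ 0 := by positivity
  generalize Real.exp (c * sF Γ x - (c * √(fF Γ q K x)) * sF Γ x + l (sF Γ x)) = ω
  generalize (t ^ 2) ^ 2 = T at hT ⊢
  generalize c * √(fF Γ q K x) = r
  field_simp
  ring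



/-- the subsolution -/
def thF {N : ℕ} (c : ℝ) (Γ : Set (Euc N)) (q : Euc N → ℝ) (K : ℝ) (x : Euc N) : ℝ :=
  Real.exp (c * sF Γ x - (c * √(fF Γ q K x)) * sF Γ x + (sF Γ x)⁻¹)

/-- the strict supersolution -/
def vF {N : ℕ} (c : ℝ) (Γ : Set (Euc N)) (q : Euc N → ℝ) (K : ℝ) (x : Euc N) : ℝ :=
  Real.exp (c * sF Γ x - (c * √(fF Γ q K x)) * sF Γ x + Real.log (sF Γ x) / 2)

lemma small_est (C : ℝ) : ∃ s0 : ℝ, 1 ≤ s0 ∧ ∀ s, s0 ≤ s → C * (s ^ 2 * Real.exp (-(s / 2))) < 1 / (4 * s ^ 3) := by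
  have h1 : Tendsto (fun s : ℝ => C * 32 * ((s / 2) ^ 5 * Real.exp (-(s / 2)))) atTop (𝓝 (C * 32 * 0)) :=
    ((Real.tendsto_pow_mul_exp_neg_atTop_nhds_zero 5).comp
      (tendsto_id.atTop_div_const (by norm_num : (0:ℝ) < 2))).const_mul _
  rw [mul_zero] at h1
  have h2 := h1.eventually (gt_mem_nhds (by norm_num : (0:ℝ) < 1 / 4))
  obtain ⟨s0, hs0⟩ := (h2.and (eventually_ge_atTop 1)).exists_forall_of_atTop
  refine ⟨max s0 1, le_max_right _ _, fun s hs => ?_⟩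
  obtain ⟨h3, h4⟩ := hs0 s ((le_max_left _ _).trans hs)
  have hs3 : 0 < 4 * s ^ 3 := by positivity
  rw [lt_div_iff₀ hs3]
  calc C * (s ^ 2 * Real.exp (-(s / 2))) * (4 * s ^ 3) =
      4 * (C * 32 * ((s / 2) ^ 5 * Real.exp (-(s / 2)))) := by ring
    _ < 4 * (1 / 4) := by gcongr
    _ = 1 := by norm_num

lemma sqrt_dist {N : ℕ} {Γ : Set (Euc N)} {x : Euc N} (h : 0 < distG Γ x) :
    √(distG Γ x) = Real.exp (-(sF Γ x / 2)) := by
  rw [Real.sqrt_eq_rpow, Real.rpow_def_of_pos h, sF]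
  congr 1; ring

lemma barriers {N k : ℕ} (hk2 : k + 2 < N) {Γ Ω : Set (Euc N)}
    (hΓ : IsSmoothSubmanifold N k Γ) (hΩo : IsOpen Ω) (hΓΩ : Γ ⊆ Ω) {q : Euc N → ℝ}
    (hq : ∀ x ∈ Ω, ContDiffAt ℝ 2 q x) (hq0 : ∀ x ∈ Ω, 0 ≤ q x) (hq1 : ∀ σ ∈ Γ, q σ ≤ 1)
    {c : ℝ} (hcN : 4 * c + 4 = 2 * ((N:ℝ) - k)) (hc0 : 0 < c) :
    ∃ L > (0:ℝ), ∃ K > (0:ℝ), ∃ R > (0:ℝ), R ≤ Real.exp (-1) ∧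
      (∀ x, distG Γ x ≤ R → x ∈ Ω ∧ ContDiffAt ℝ 2 (nu Γ) x ∧
        |q x - q (nu Γ x)| ≤ L * distG Γ x ∧ distG Γ x ≤ fF Γ q K x) ∧
      ∀ x, 0 < distG Γ x → distG Γ x ≤ R → 1 ≤ sF Γ x ∧ ContDiffAt ℝ 2 (thF c Γ q K) x ∧
        ContDiffAt ℝ 2 (vF c Γ q K) x ∧
        -lap (thF c Γ q K) x ≤ c ^ 2 * q x / distG Γ x ^ 2 * thF c Γ q K x ∧
        c ^ 2 * q x / distG Γ x ^ 2 * vF c Γ q K x < -lap (vF c Γ q K) x := by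
  obtain ⟨L, hL, K, hK, R, hR, hR1, C8, hC8, h1, h2⟩ :=
    barrier_est hk2 hΓ hΩo hΓΩ hq hq0 hq1 hcN hc0
  obtain ⟨s0, hs01, hs0⟩ := small_est C8
  refine ⟨L, hL, K, hK, min R (Real.exp (-s0)), by positivity, (min_le_left _ _).trans hR1,
    fun x hx => h1 x (hx.trans (min_le_left _ _)), fun x hpos hx => ?_⟩
  obtain ⟨hs, hr, hmain⟩ := h2 x hpos (hx.trans (min_le_left _ _))
  have hss0 : s0 ≤ sF Γ x := by
    rw [sF, le_neg, ← Real.log_exp (-s0)]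
    exact Real.log_le_log hpos (hx.trans (min_le_right _ _))
  have hE := hs0 _ hss0
  rw [← sqrt_dist hpos] at hE
  have hs1 : 1 ≤ sF Γ x := hs01.trans hss0
  have hspos : 0 < sF Γ x := by linarith
  have hne : sF Γ x ≠ 0 := hspos.ne'
  have hd2 : 0 < distG Γ x ^ 2 := by positivity
  have hbase : ContDiffAt ℝ 2 (fun y => c * sF Γ y - (c * √(fF Γ q K y)) * sF Γ y) x :=
    (contDiffAt_const.mul hs).sub (hr.mul hs)
  have hsq : sF Γ x ^ 2 ≥ 1 := by nlinarith
  refine ⟨hs1, ?_, ?_, ?_, ?_⟩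
  · exact (hbase.add (hs.inv hne)).exp
  · exact (hbase.add ((hs.log hne).div_const 2)).exp
  · obtain ⟨E, hE1, hE2⟩ := hmain (fun t => t⁻¹) (fun t => -(t ^ 2)⁻¹) (2 / sF Γ x ^ 3)
      (contDiffAt_id.inv hne)
      (by
        filter_upwards [isOpen_ne.mem_nhds hne] with t ht
        exact hasDerivAt_inv ht)
      (by
        have := ((hasDerivAt_pow 2 (sF Γ x)).inv (by positivity)).neg
        refine this.congr_deriv ?_
        push_cast; field_simp)
      (by
        rw [abs_neg, abs_inv, abs_of_nonneg (by positivity)]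
        exact inv_le_one_of_one_le₀ hsq)
    change lap (thF c Γ q K) x + _ * thF c Γ q K x = thF c Γ q K x / _ * _ at hE2
    have : 0 ≤ thF c Γ q K x / distG Γ x ^ 2 * (-2 * (c * √(fF Γ q K x)) * (-(sF Γ x ^ 2)⁻¹) +
      (-(sF Γ x ^ 2)⁻¹) ^ 2 + 2 / sF Γ x ^ 3 + E) := by
      refine mul_nonneg (div_nonneg (Real.exp_pos _).le hd2.le) ?_
      have a1 : 0 ≤ -2 * (c * √(fF Γ q K x)) * (-(sF Γ x ^ 2)⁻¹) := by
        have : 0 ≤ 2 * (c * √(fF Γ q K x)) * (sF Γ x ^ 2)⁻¹ := by positivity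
        linarith
      have a2 : 1 / (4 * sF Γ x ^ 3) ≤ 2 / sF Γ x ^ 3 := by
        rw [div_le_div_iff₀ (by positivity) (by positivity)]
        have : 0 < sF Γ x ^ 3 := by positivity
        linarith
      have a3 := neg_abs_le E
      have a4 := sq_nonneg (-(sF Γ x ^ 2)⁻¹)
      linarith
    linarith
  · obtain ⟨E, hE1, hE2⟩ := hmain (fun t => Real.log t / 2) (fun t => t⁻¹ / 2)
      (-(sF Γ x ^ 2)⁻¹ / 2)
      ((contDiffAt_id.log hne).div_const 2)
      (by
        filter_upwards [isOpen_ne.mem_nhds hne] with t ht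
        exact (Real.hasDerivAt_log ht).div_const 2)
      ((hasDerivAt_inv hne).div_const 2)
      (by
        rw [abs_of_nonneg (by positivity)]
        have := inv_le_one_of_one_le₀ hs1
        linarith)
    change lap (vF c Γ q K) x + _ * vF c Γ q K x = vF c Γ q K x / _ * _ at hE2
    have : vF c Γ q K x / distG Γ x ^ 2 * (-2 * (c * √(fF Γ q K x)) * ((sF Γ x)⁻¹ / 2) +
      ((sF Γ x)⁻¹ / 2) ^ 2 + -(sF Γ x ^ 2)⁻¹ / 2 + E) < 0 := by
      refine mul_neg_of_pos_of_neg (div_pos (Real.exp_pos _) hd2) ?_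
      have a1 : 0 ≤ 2 * (c * √(fF Γ q K x)) * ((sF Γ x)⁻¹ / 2) := by positivity
      have a2 : 1 / (4 * sF Γ x ^ 3) ≤ (sF Γ x ^ 2)⁻¹ / 4 := by
        rw [← one_div, div_div, div_le_div_iff₀ (by positivity) (by positivity)]
        nlinarith
      have a3 := le_abs_self E
      have a4 : ((sF Γ x)⁻¹ / 2) ^ 2 = (sF Γ x ^ 2)⁻¹ / 4 := by field_simp; norm_num
      rw [a4]
      linarith
    linarith



lemma int_test {N : ℕ} {O K : Set (Euc N)} {u g : Euc N → ℝ}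
    (hloc : LocallyIntegrableOn u O volume) (hK : IsCompact K) (hKO : K ⊆ O) (hg : Continuous g)
    (hgK : ∀ x, x ∉ K → g x = 0) (hO : MeasurableSet O) : IntegrableOn (fun x => u x * g x) O := by
  have h1 : IntegrableOn (fun x => u x * g x) K :=
    (hloc.integrableOn_compact_subset hKO hK).mul_continuousOn hg.continuousOn hK
  exact h1.of_forall_sdiff_eq_zero hO fun x hx => by rw [hgK x hx.2, mul_zero]

lemma lap_test_continuous {N : ℕ} {φ : Euc N → ℝ} (h : ContDiff ℝ (⊤ : ℕ∞) φ) :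
    Continuous (lap φ) :=
  continuous_iff_continuousAt.2 fun _ => continuousAt_lap
    (h.contDiffAt.of_le (WithTop.coe_le_coe.2 (le_top : (2:ℕ∞) ≤ ⊤)))

lemma weak_split {N : ℕ} {O : Set (Euc N)} {u P v : Euc N → ℝ} (hO : IsOpen O)
    (hloc : LocallyIntegrableOn u O volume)
    (hPu : LocallyIntegrableOn (fun x => P x * u x) O volume)
    (hv0 : ∀ᵐ x ∂volume, x ∈ O → 0 ≤ v x)
    (hsuper : ∀ φ : Euc N → ℝ, IsTestFun O φ → (∀ x, 0 ≤ φ x) →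
      ∫ x in O, v x * φ x ≤ ∫ x in O, u x * (-(lap φ x) - P x * φ x))
    {φ : Euc N → ℝ} (hφ : IsTestFun O φ) (hφ0 : ∀ x, 0 ≤ φ x) :
    ∫ x in O, P x * u x * φ x ≤ ∫ x in O, u x * (-lap φ x) := by
  obtain ⟨h1, h2, h3⟩ := id hφ
  have i1 : IntegrableOn (fun x => P x * u x * φ x) O :=
    int_test hPu h2 h3 h1.continuous (fun x hx => image_eq_zero_of_notMem_tsupport hx)
      hO.measurableSet
  have i2 : IntegrableOn (fun x => u x * (-lap φ x)) O :=
    int_test hloc h2 h3 (lap_test_continuous h1).neg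
      (fun x hx => by rw [lap_zero_off hx, neg_zero]) hO.measurableSet
  have h4 : 0 ≤ ∫ x in O, v x * φ x := by
    refine setIntegral_nonneg_ae hO.measurableSet ?_
    filter_upwards [hv0] with x hx hxO
    exact mul_nonneg (hx hxO) (hφ0 x)
  have h5 := h4.trans (hsuper φ hφ hφ0)
  have h6 : ∫ x in O, u x * (-(lap φ x) - P x * φ x) =
      ∫ x in O, (u x * (-lap φ x) - P x * u x * φ x) := by
    congr 1; ext x; ring
  rw [h6, integral_sub i2 i1] at h5
  linarith

lemma weak_restrict {N : ℕ} {O U : Set (Euc N)} {u P : Euc N → ℝ} (hO : IsOpen O)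
    (hUO : U ⊆ O) 
    (hw : ∀ φ : Euc N → ℝ, IsTestFun O φ → (∀ x, 0 ≤ φ x) →
      ∫ x in O, P x * u x * φ x ≤ ∫ x in O, u x * (-lap φ x))
    {φ : Euc N → ℝ} (hφ : IsTestFun U φ) (hφ0 : ∀ x, 0 ≤ φ x) :
    ∫ x in U, P x * u x * φ x ≤ ∫ x in U, u x * (-lap φ x) := by
  have h := hw φ ⟨hφ.1, hφ.2.1, hφ.2.2.trans hUO⟩ hφ0
  rw [setIntegral_eq_of_subset_of_forall_sdiff_eq_zero hO.measurableSet hUO,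
    setIntegral_eq_of_subset_of_forall_sdiff_eq_zero hO.measurableSet hUO] at h
  · exact h
  · intro x hx
    rw [lap_zero_off fun h => hx.2 (hφ.2.2 h), neg_zero, mul_zero]
  · intro x hx
    rw [image_eq_zero_of_notMem_tsupport fun h => hx.2 (hφ.2.2 h), mul_zero]

lemma weak_sup {N : ℕ} {O : Set (Euc N)} {u P : Euc N → ℝ} (hO : IsOpen O)
    (hu0 : ∀ᵐ x ∂volume, x ∈ O → 0 ≤ u x) (hP0 : ∀ x ∈ O, 0 ≤ P x)
    (hw : ∀ φ : Euc N → ℝ, IsTestFun O φ → (∀ x, 0 ≤ φ x) →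
      ∫ x in O, P x * u x * φ x ≤ ∫ x in O, u x * (-lap φ x))
    {φ : Euc N → ℝ} (hφ : IsTestFun O φ) (hφ0 : ∀ x, 0 ≤ φ x) :
    ∫ x in O, u x * lap φ x ≤ 0 := by
  have h := hw φ hφ hφ0
  have h4 : 0 ≤ ∫ x in O, P x * u x * φ x := by
    refine setIntegral_nonneg_ae hO.measurableSet ?_
    filter_upwards [hu0] with x hx hxO
    exact mul_nonneg (mul_nonneg (hP0 x hxO) (hx hxO)) (hφ0 x)
  simp only [mul_neg] at h
  rw [integral_neg] at h
  linarith

/-- comparison of the two profiles near the submanifold -/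
lemma th_le_v {N : ℕ} {c : ℝ} {Γ : Set (Euc N)} {q : Euc N → ℝ} {K A : ℝ} {x : Euc N} (hA : 0 < A)
    (hs : 1 ≤ sF Γ x) (h : 2 * Real.log A + 2 ≤ Real.log (sF Γ x)) :
    A * thF c Γ q K x ≤ vF c Γ q K x := by
  rw [thF, vF]
  conv_lhs => rw [← Real.exp_log hA]
  rw [← Real.exp_add, Real.exp_le_exp]
  have : (sF Γ x)⁻¹ ≤ 1 := inv_le_one_of_one_le₀ hs
  linarith

lemma exists_eta (A : ℝ) : ∃ η > (0:ℝ), ∀ d, 0 < d → d < η → A ≤ Real.log (-Real.log d) := by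
  refine ⟨Real.exp (-Real.exp A), Real.exp_pos _, fun d hd hdη => ?_⟩
  have h1 : Real.log d < -Real.exp A := by
    rw [← Real.log_exp (-Real.exp A)]; exact Real.log_lt_log hd hdη
  rw [← Real.log_exp A]
  exact Real.log_le_log (Real.exp_pos _) (by linarith)

/-- `θ_a` is dominated by the subsolution -/
lemma thetaA_le {N k : ℕ} {Γ : Set (Euc N)} {q : Euc N → ℝ} {c L K a : ℝ} {x : Euc N}
    (hcN : c = ((N:ℝ) - k - 2) / 2) (hc0 : 0 < c) (hL : 0 < L) (hK : 0 < K) (ha : a < 0)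
    (hpos : 0 < distG Γ x) (hs : 1 ≤ sF Γ x) (hproj : projG Γ x = nu Γ x)
    (hqn : q (nu Γ x) ≤ 1)
    (hlip : |q x - q (nu Γ x)| ≤ L * distG Γ x) (hf : distG Γ x ≤ fF Γ q K x) :
    thetaA k Γ q a x ≤ 2 * Real.exp (c * √(L + K) * 2) * thF c Γ q K x := by
  set d := distG Γ x with hd
  set s := sF Γ x with hsd
  have hlog : Real.log d = -s := by rw [hsd, sF, neg_neg]
  have habs : |Real.log d| = s := by rw [hlog, abs_neg, abs_of_nonneg (show (0:ℝ) ≤ s by linarith)]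
  set g := 1 - q (nu Γ x) + d with hg
  have hg0 : 0 ≤ g := by rw [hg]; linarith
  have hsa : √(abarF k Γ q x) = c * √g := by
    rw [abarF, hproj, ← hcN, Real.sqrt_mul (sq_nonneg c), Real.sqrt_sq hc0.le]
  have halpha : alphaF k Γ q x = c - c * √g := by rw [alphaF, hsa, hcN]
  have hpow : d ^ (-(alphaF k Γ q x)) = Real.exp (c * s - c * √g * s) := by
    rw [Real.rpow_def_of_pos hpos, hlog, halpha]; congr 1; ring
  have hsa1 : s ^ a ≤ 1 := Real.rpow_le_one_of_one_le_of_nonpos hs ha.le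
  have hth : thetaA k Γ q a x ≤ 2 * Real.exp (c * s - c * √g * s) := by
    rw [thetaA, omegaA, omegaA, ← hd, hpow, habs, Real.rpow_zero, mul_one]
    have := mul_le_mul_of_nonneg_left hsa1 (Real.exp_pos (c * s - c * √g * s)).le
    linarith
  refine hth.trans ?_
  rw [mul_assoc 2 (Real.exp (c * √(L + K) * 2))]
  refine mul_le_mul_of_nonneg_left ?_ (zero_le_two (α := ℝ))
  rw [thF, ← Real.exp_add, Real.exp_le_exp]
  have h1 : fF Γ q K x ≤ g + (L + K) * d := by
    rw [abs_le] at hlip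
    rw [fF, hg]
    linarith [hlip.1]
  have h2 : √(fF Γ q K x) ≤ √g + √(L + K) * √d := by
    refine Real.sqrt_le_iff.2 ⟨by positivity, h1.trans ?_⟩
    have e1 := Real.sq_sqrt hg0
    have e2 := Real.sq_sqrt (by positivity : 0 ≤ L + K)
    have e3 := Real.sq_sqrt hpos.le
    have e4 : 0 ≤ √g * (√(L + K) * √d) := by positivity
    calc g + (L + K) * d = √g ^ 2 + √(L + K) ^ 2 * √d ^ 2 := by rw [e1, e2, e3]
      _ ≤ √g ^ 2 + √(L + K) ^ 2 * √d ^ 2 + 2 * (√g * (√(L + K) * √d)) := by linarith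
      _ = _ := by ring
  have h3 : √d * s ≤ 2 := by
    rw [hd, sqrt_dist hpos, ← hsd]
    have h4 := Real.add_one_le_exp (s / 2)
    rw [Real.exp_neg, inv_mul_le_iff₀ (Real.exp_pos _)]
    linarith
  have h4 : c * √(fF Γ q K x) * s ≤ c * √g * s + c * √(L + K) * 2 := by
    calc c * √(fF Γ q K x) * s ≤ c * (√g + √(L + K) * √d) * s := by gcongr
      _ = c * √g * s + c * √(L + K) * (√d * s) := by ring
      _ ≤ _ := by gcongr
  have h5 : 0 ≤ s⁻¹ := by positivity
  linarith



/-- **Step III of the proof of Theorem 4.1.** Any nontrivial nonnegative distributional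
supersolution of `-Δu - ((N-k-2)²/4) δ⁻² q u ≥ uᵖ` on `Ω \\ Γ` is bounded below, on every
sufficiently small tube `Γ_β`, by a positive multiple of `θ_a = ω₀ + ω_a` (`a < -1/2`). -/
theorem lower_bound_thetaA {N k : ℕ} (hN : 4 ≤ N) (hk1 : 1 ≤ k) (hk2 : k + 2 < N)
    (Γ Ω : Set (Euc N)) (hΓ : IsSmoothSubmanifold N k Γ)
    (hΩ : IsSmoothDomain Ω) (hΓΩ : Γ ⊆ Ω)
    (q : Euc N → ℝ) (hq : ContDiffOn ℝ 2 q (closure Ω))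
    (hq0 : ∀ x ∈ Ω, 0 ≤ q x)
    (hq1 : ∀ σ ∈ Γ, q σ ≤ 1) (hqmax : ∃ σ ∈ Γ, q σ = 1)
    (a : ℝ) (ha : a < -(1 / 2 : ℝ))
    (p : ℝ) (hp : 1 < p)
    (u : Euc N → ℝ)
    (hu0 : ∀ᵐ x ∂volume, x ∈ Ω \ Γ → 0 ≤ u x)
    (hunt : ¬ (∀ᵐ x ∂volume, x ∈ Ω \ Γ → u x = 0))
    (huloc : LocallyIntegrableOn u (Ω \ Γ) volume)
    (hup : LocallyIntegrableOn (fun x => u x ^ p) (Ω \ Γ) volume)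
    (hqu : LocallyIntegrableOn (fun x => (((N : ℝ) - k - 2) ^ 2 / 4) * distG Γ x ^ (-2 : ℝ) * q x * u x) (Ω \ Γ) volume)
    (hsuper : ∀ φ : Euc N → ℝ, IsTestFun (Ω \ Γ) φ → (∀ x, 0 ≤ φ x) →
      ∫ x in Ω \ Γ, u x ^ p * φ x ≤
        ∫ x in Ω \ Γ, u x * (-(lap φ x) - (((N : ℝ) - k - 2) ^ 2 / 4) * distG Γ x ^ (-2 : ℝ) * q x * φ x)) :
    ∃ β₁ > (0:ℝ), ∀ β, 0 < β → β < β₁ → ∃ C > (0:ℝ),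
      ∀ᵐ x ∂volume, x ∈ tube Ω Γ β → C * thetaA k Γ q a x ≤ u x := by
  obtain ⟨hΩo, -, hΩc, -⟩ := hΩ
  obtain ⟨hc, hne, -⟩ := id hΓ
  set c : ℝ := ((N : ℝ) - k - 2) / 2 with hcdef
  have hkN : (k : ℝ) + 2 < N := by exact_mod_cast hk2
  have hc0 : 0 < c := by rw [hcdef]; linarith
  have hcN : 4 * c + 4 = 2 * ((N : ℝ) - k) := by rw [hcdef]; ring
  have hqcd : ∀ x ∈ Ω, ContDiffAt ℝ 2 q x := fun x hx =>
    (hq x (subset_closure hx)).contDiffAt (mem_of_superset (hΩo.mem_nhds hx) subset_closure)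
  obtain ⟨L, hL, K, hK, R, hR, hR1, hgeo, hbar⟩ :=
    barriers hk2 hΓ hΩo hΓΩ hqcd hq0 hq1 hcN hc0
  have hO : IsOpen (Ω \ Γ) := hΩo.sdiff hc.isClosed
  have hPeq : ∀ x, (((N : ℝ) - k - 2) ^ 2 / 4) * distG Γ x ^ (-2 : ℝ) * q x =
      c ^ 2 * q x / distG Γ x ^ 2 := by
    intro x
    have h0 : 0 ≤ distG Γ x := infDist_nonneg
    rw [Real.rpow_neg h0, Real.rpow_two, hcdef]
    ring
  simp only [hPeq] at hqu hsuper
  set P : Euc N → ℝ := fun x => c ^ 2 * q x / distG Γ x ^ 2 with hP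
  have hP0 : ∀ x ∈ Ω, 0 ≤ P x := fun x hx =>
    div_nonneg (mul_nonneg (sq_nonneg c) (hq0 x hx)) (sq_nonneg _)
  have hw := fun (φ : Euc N → ℝ) (hφ : IsTestFun (Ω \ Γ) φ) (hφ0 : ∀ x, 0 ≤ φ x) =>
    weak_split (P := P) (v := fun x => u x ^ p) hO huloc hqu
      (by filter_upwards [hu0] with x hx hxO using Real.rpow_nonneg (hx hxO) p) hsuper hφ hφ0
  have hcont : Continuous (distG Γ) := continuous_infDist_pt Γ
  have hpos_iff : ∀ x, x ∉ Γ → 0 < distG Γ x := fun x hx =>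
    (hc.isClosed.notMem_iff_infDist_pos hne).1 hx
  have hnot : ∀ x, 0 < distG Γ x → x ∉ Γ := fun x hx =>
    (hc.isClosed.notMem_iff_infDist_pos hne).2 hx
  have hshell : ∀ η b : ℝ, 0 ≤ b → IsCompact {x | η ≤ distG Γ x ∧ distG Γ x ≤ b} := by
    intro η b hb
    refine (hc.cthickening (r := b)).of_isClosed_subset
      ((isClosed_le continuous_const hcont).inter (isClosed_le hcont continuous_const)) ?_
    intro x hx
    rw [Metric.mem_cthickening_iff]
    exact ENNReal.le_ofReal_iff_toReal_le (infEDist_ne_top hne) hb |>.2 hx.2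
  refine ⟨R, hR, fun β hβ hβR => ?_⟩
  set β' := (β + R) / 2 with hβ'
  have hββ' : β < β' := by rw [hβ']; linarith
  have hβ'R : β' < R := by rw [hβ']; linarith
  have hSc := hshell β β' (hβ.trans hββ').le
  set S := {x | β ≤ distG Γ x ∧ distG Γ x ≤ β'} with hS
  obtain ⟨c0, hc00, hc0u⟩ := positivity_compact hO
    (diff_preconnected hk2 hΓ hΩo hΩc.isPreconnected) hu0 hunt huloc
    (fun φ hφ hφ0 => weak_sup hO hu0 (fun x hx => hP0 x hx.1) hw hφ hφ0) hSc
    (fun x hx => ⟨(hgeo x (hx.2.trans hβ'R.le)).1, hnot x (hβ.trans_le hx.1)⟩)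
  obtain ⟨T0, hT0⟩ := hSc.exists_bound_of_continuousOn (f := thF c Γ q K) fun x hx =>
    (hbar x (hβ.trans_le hx.1) (hx.2.trans hβ'R.le)).2.1.continuousAt.continuousWithinAt
  set T := |T0| + 1 with hT
  have hTpos : 0 < T := by positivity
  have hthT : ∀ x ∈ S, thF c Γ q K x ≤ T := fun x hx => by
    have := hT0 x hx
    rw [Real.norm_eq_abs] at this
    linarith [le_abs_self (thF c Γ q K x), le_abs_self T0]
  set κ := c0 / T with hκ
  have hκ0 : 0 < κ := by positivity
  set U := {x | 0 < distG Γ x ∧ distG Γ x < β'} with hU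
  have hUo : IsOpen U :=
    (isOpen_lt continuous_const hcont).inter (isOpen_lt hcont continuous_const)
  have hUΩ : ∀ x ∈ U, x ∈ Ω := fun x hx => (hgeo x (hx.2.trans hβ'R).le).1
  have hUO : U ⊆ Ω \ Γ := fun x hx => ⟨hUΩ x hx, hnot x hx.1⟩
  have hbarU := fun x (hx : x ∈ U) => hbar x hx.1 (hx.2.trans hβ'R).le
  have hth0 : ∀ x, 0 < thF c Γ q K x := fun x => Real.exp_pos _
  have hv0 : ∀ x, 0 < vF c Γ q K x := fun x => Real.exp_pos _
  have hcomp : ∀ᵐ x ∂volume, x ∈ U → κ * thF c Γ q K x ≤ u x := by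
    refine comparison (P := P) (θ := fun x => κ * thF c Γ q K x) (V := vF c Γ q K) hUo ?_
      (fun x hx => hP0 x (hUΩ x hx)) ?_ (huloc.mono_set hUO)
      (fun φ hφ hφ0 => weak_restrict hO hUO hw hφ hφ0)
      (fun x hx => contDiffAt_const.mul (hbarU x hx).2.1) (fun x hx => (hbarU x hx).2.2.1)
      (fun x _ => hv0 x) ?_ (fun x hx => (hbarU x hx).2.2.2.2) ?_ ?_
    · intro x hx
      have h1 : ContinuousAt q x := (hqcd x (hUΩ x hx)).continuousAt
      have h2 : distG Γ x ^ 2 ≠ 0 := pow_ne_zero 2 hx.1.ne'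
      exact ((continuousAt_const.mul h1).div (hcont.continuousAt.pow 2) h2).continuousWithinAt
    · filter_upwards [hu0] with x hx hxU using hx (hUO hxU)
    · intro x hx
      rw [lap_const_mul κ (hbarU x hx).2.1]
      have := mul_le_mul_of_nonneg_left (hbarU x hx).2.2.2.1 hκ0.le
      calc -(κ * lap (thF c Γ q K) x) = κ * -lap (thF c Γ q K) x := by ring
        _ ≤ κ * (P x * thF c Γ q K x) := this
        _ = P x * (κ * thF c Γ q K x) := by ring
    · refine ⟨κ * Real.exp 1, fun x hx => ?_⟩
      have h1 := (hbarU x hx).1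
      have h2 := th_le_v (c := c) (q := q) (K := K) (Real.exp_pos (-1)) h1
        (by rw [Real.log_exp]; linarith [Real.log_nonneg h1])
      rw [mul_assoc]
      refine mul_le_mul_of_nonneg_left ?_ hκ0.le
      rw [Real.exp_neg, inv_mul_le_iff₀ (Real.exp_pos _)] at h2
      exact h2
    · intro M hM
      have hA : 0 < κ / M := by positivity
      obtain ⟨η, hη, hηA⟩ := exists_eta (2 * Real.log (κ / M) + 2)
      refine ⟨{x | η ≤ distG Γ x ∧ distG Γ x ≤ β}, hshell η β hβ.le,
        fun x hx => ⟨hη.trans_le hx.1, hx.2.trans_lt hββ'⟩, ?_⟩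
      filter_upwards [hu0, hc0u] with x hx1 hx2 hxU hxK
      by_cases hxη : distG Γ x < η
      · have h3 := th_le_v (c := c) (q := q) (K := K) hA (hbarU x hxU).1 (hηA _ hxU.1 hxη)
        have h4 : κ * thF c Γ q K x ≤ M * vF c Γ q K x := by
          rw [div_mul_eq_mul_div, div_le_iff₀ hM] at h3
          linarith
        linarith [hx1 (hUO hxU)]
      · have hxβ : β < distG Γ x := by
          by_contra h
          exact hxK ⟨not_lt.1 hxη, not_lt.1 h⟩
        have hxS : x ∈ S := ⟨hxβ.le, hxU.2.le⟩
        have h3 : κ * thF c Γ q K x ≤ c0 := by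
          calc κ * thF c Γ q K x ≤ κ * T := mul_le_mul_of_nonneg_left (hthT x hxS) hκ0.le
            _ = c0 := by rw [hκ]; field_simp
        have h4 := mul_pos hM (hv0 x)
        linarith [hx2 hxS]
  set D := 2 * Real.exp (c * √(L + K) * 2) with hD
  have hD0 : 0 < D := by positivity
  refine ⟨κ / D, by positivity, ?_⟩
  have hnull : ∀ᵐ x ∂(volume : Measure (Euc N)), x ∉ Γ :=
    measure_eq_zero_iff_ae_notMem.1 (vol_zero (by omega) hΓ)
  filter_upwards [hcomp, hnull] with x hx hxΓ hxt
  have hpos := hpos_iff x hxΓ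
  have hxβ : distG Γ x < β := hxt.2
  have hxR : distG Γ x ≤ R := (hxβ.trans hβR).le
  obtain ⟨-, hnucd, hlip, hf⟩ := hgeo x hxR
  have hle := thetaA_le (k := k) hcdef hc0 hL hK (by linarith : a < 0) hpos (hbar x hpos hxR).1
    (projG_eq hc hne (hnucd.differentiableAt (by norm_num)) hpos) (hq1 _ (nu_spec hc hne x).1)
    hlip hf
  refine le_trans ?_ (hx ⟨hpos, hxβ.trans hββ'⟩)
  calc κ / D * thetaA k Γ q a x ≤ κ / D * (D * thF c Γ q K x) :=
        mul_le_mul_of_nonneg_left hle (by positivity)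
    _ = κ * thF c Γ q K x := by field_simp
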